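/- arXiv:2102.04240 — 2 statements merged into one kernel-verified Lean document; each statement's English description precedes it below -/
import Mathlib

section
/- Let d, r ≥ 7. It is undecidable whether τ_n(ρ) is positive semidefinite for all n ∈ ℕ: the set of tuples ρ = (ρ_{α,β})_{α,β=1,…,r} of d×d matrices with Gaussian-rational entries (entries in ℚ + iℚ) such that τ_n(ρ) := Σ_{α_1,…,α_n=1}^r ρ_{α_1,α_2} ⊗ ρ_{α_2,α_3} ⊗ ⋯ ⊗ ρ_{α_n,α_1} is positive semidefinite for every n ≥ 1 is not a computable (decidable) set. -/
open Matrix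
open scoped ComplexOrder

/-- Interpret a table of Gaussian-rational numbers (pairs `(p, q)` representing `p + qi`)
as a complex matrix. -/
noncomputable def toMatC {d : ℕ} (f : Fin d → Fin d → ℚ × ℚ) : Matrix (Fin d) (Fin d) ℂ :=
  Matrix.of fun i j => ((f i j).1 : ℂ) + ((f i j).2 : ℂ) * Complex.I

/-- `tauMat ρ n` is the matrix
`τ_{n+1}(ρ) = Σ_{α₁,…,α_{n+1}} ρ_{α₁,α₂} ⊗ ρ_{α₂,α₃} ⊗ ⋯ ⊗ ρ_{α_{n+1},α₁} ∈ Mat_{d^{n+1}}`,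
written entrywise via the Kronecker product identification. -/
noncomputable def tauMat {d r : ℕ} (ρ : Fin r → Fin r → Matrix (Fin d) (Fin d) ℂ) (n : ℕ) :
    Matrix (Fin (n + 1) → Fin d) (Fin (n + 1) → Fin d) ℂ :=
  Matrix.of fun i j =>
    ∑ α : Fin (n + 1) → Fin r, ∏ k : Fin (n + 1), ρ (α k) (α (k + 1)) (i k) (j k)


namespace TauUndec
section RatEncoding
open Encodable

theorem encode_ofEncodableOfInfinite {α : Type*} [e : Encodable α] [Infinite α]
    [DecidablePred (· ∈ Set.range (@encode α _))] (x : α) :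
    @encode α (Denumerable.ofEncodableOfInfinite α).toEncodable x =
      ((List.range (encode x)).filter (· ∈ Set.range (@encode α _))).length := by
  rw [← List.countP_eq_length_filter]
  have : @encode α (Denumerable.ofEncodableOfInfinite α).toEncodable x =
    @List.countP _ (fun n => @decide _ (decidableRangeEncode α n)) (List.range (encode x)) := rfl
  rw [this]
  congr!

/-- The absolute value of the integer with code `a`. -/
def natAbsOfCode (a : ℕ) : ℕ := (a + 1) / 2

theorem encode_int_ofNat (n : ℕ) : encode (n : ℤ) = 2 * n := rfl

theorem encode_int_negSucc (n : ℕ) : encode (Int.negSucc n) = 2 * n + 1 := rfl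

theorem natAbs_of_encode (z : ℤ) : z.natAbs = natAbsOfCode (encode z) := by
  cases z with
  | ofNat n =>
    rw [Int.ofNat_eq_natCast, encode_int_ofNat]; simp [natAbsOfCode]; omega
  | negSucc n => rw [encode_int_negSucc]; simp [natAbsOfCode]; omega

theorem exists_encode_int (a : ℕ) : ∃ z : ℤ, encode z = a := by
  rcases Nat.even_or_odd' a with ⟨n, rfl | rfl⟩
  · exact ⟨n, encode_int_ofNat n⟩
  · exact ⟨Int.negSucc n, encode_int_negSucc n⟩

theorem encode_rat (q : ℚ) : @encode ℚ Rat.instEncodable q = Nat.pair (encode q.num) q.den := rfl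

theorem mem_range_encode_rat (m : ℕ) : m ∈ Set.range (@encode ℚ Rat.instEncodable) ↔
    m.unpair.2 ≠ 0 ∧ ∀ x < m.unpair.2 + 1,
      ¬ (natAbsOfCode m.unpair.1 % x = 0 ∧ m.unpair.2 % x = 0 ∧ x ≠ 1) := by
  have key : ∀ a d : ℕ, d ≠ 0 → ((∀ x < d + 1, ¬ (a % x = 0 ∧ d % x = 0 ∧ x ≠ 1)) ↔
      a.Coprime d) := by
    intro a d hd
    constructor
    · intro h
      by_contra hc
      refine h (a.gcd d) (Nat.lt_succ_of_le (Nat.gcd_le_right _ (Nat.pos_of_ne_zero hd)))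
        ⟨Nat.mod_eq_zero_of_dvd (Nat.gcd_dvd_left _ _),
          Nat.mod_eq_zero_of_dvd (Nat.gcd_dvd_right _ _), hc⟩
    · rintro h x - ⟨h1, h2, h3⟩
      exact h3 (Nat.eq_one_of_dvd_coprimes h (Nat.dvd_of_mod_eq_zero h1) (Nat.dvd_of_mod_eq_zero h2))
  constructor
  · rintro ⟨q, rfl⟩
    rw [encode_rat, Nat.unpair_pair]
    refine ⟨q.den_nz, ?_⟩
    rw [key _ _ q.den_nz, ← natAbs_of_encode]
    exact q.reduced
  · rintro ⟨h1, h2⟩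
    rw [key _ _ h1] at h2
    obtain ⟨z, hz⟩ := exists_encode_int m.unpair.1
    rw [← hz, ← natAbs_of_encode] at h2
    refine ⟨⟨z, m.unpair.2, h1, h2⟩, ?_⟩
    rw [encode_rat]
    simp only [hz, Nat.pair_unpair]

theorem primrecPred_mem_range_encode_rat :
    PrimrecPred (· ∈ Set.range (@encode ℚ Rat.instEncodable)) := by
  have hrel : PrimrecRel fun (x m : ℕ) =>
      ¬ (natAbsOfCode m.unpair.1 % x = 0 ∧ m.unpair.2 % x = 0 ∧ x ≠ 1) := by
    have hx : Primrec fun p : ℕ × ℕ => p.1 := Primrec.fst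
    have hm1 : Primrec fun p : ℕ × ℕ => natAbsOfCode p.2.unpair.1 :=
      Primrec.nat_div.comp (Primrec.succ.comp (Primrec.fst.comp (Primrec.unpair.comp Primrec.snd)))
        (Primrec.const 2)
    have hm2 : Primrec fun p : ℕ × ℕ => p.2.unpair.2 :=
      Primrec.snd.comp (Primrec.unpair.comp Primrec.snd)
    refine PrimrecPred.not (PrimrecPred.and ?_ (PrimrecPred.and ?_ (PrimrecPred.not ?_)))
    · exact Primrec.eq.comp (Primrec.nat_mod.comp hm1 hx) (Primrec.const 0)
    · exact Primrec.eq.comp (Primrec.nat_mod.comp hm2 hx) (Primrec.const 0)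
    · exact Primrec.eq.comp hx (Primrec.const 1)
  have hs : Primrec fun m : ℕ => m.unpair.2 := Primrec.snd.comp Primrec.unpair
  have hall := hrel.forall_lt
  refine PrimrecPred.of_eq (PrimrecPred.and (PrimrecPred.not
    (Primrec.eq.comp hs (Primrec.const 0)))
    (PrimrecRel.comp hall (Primrec.succ.comp hs) Primrec.id)) fun m => ?_
  rw [mem_range_encode_rat]
  rfl

theorem primrec_rat_of_primrec_encode {α : Type*} [Primcodable α] (f : α → ℚ)
    (hf : Primrec fun a => @encode ℚ Rat.instEncodable (f a)) : Primrec f := by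
  classical
  rw [← Primrec.encode_iff]
  have h1 : Primrec fun L : List ℕ => L.filter (· ∈ Set.range (@encode ℚ Rat.instEncodable)) :=
    Primrec.listFilter primrecPred_mem_range_encode_rat
  refine (Primrec.list_length.comp (h1.comp (Primrec.list_range.comp hf))).of_eq fun a => ?_
  exact (encode_ofEncodableOfInfinite (f a)).symm

theorem primrec_natCast_rat : Primrec fun n : ℕ => (n : ℚ) := by
  refine primrec_rat_of_primrec_encode _ ?_
  refine (Primrec₂.natPair.comp (Primrec.nat_mul.comp (Primrec.const 2) Primrec.id)
    (Primrec.const 1)).of_eq fun n => ?_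
  rfl

theorem primrec_neg_natCast_rat : Primrec fun n : ℕ => -(n : ℚ) := by
  refine primrec_rat_of_primrec_encode _ ?_
  refine (Primrec₂.natPair.comp (Primrec.nat_sub.comp (Primrec.nat_mul.comp (Primrec.const 2)
    Primrec.id) (Primrec.const 1)) (Primrec.const 1)).of_eq fun n => ?_
  rw [encode_rat]
  cases n with
  | zero => rfl
  | succ n => rfl

theorem primrec_intCast_mul_natCast_rat (c : ℤ) {α : Type*} [Primcodable α] {f : α → ℕ}
    (hf : Primrec f) : Primrec fun a => (c : ℚ) * (f a : ℚ) := by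
  rcases Int.eq_nat_or_neg c with ⟨k, rfl | rfl⟩
  · refine (primrec_natCast_rat.comp (Primrec.nat_mul.comp (Primrec.const k) hf)).of_eq ?_
    intro a; push_cast; ring
  · refine (primrec_neg_natCast_rat.comp (Primrec.nat_mul.comp (Primrec.const k) hf)).of_eq ?_
    intro a; push_cast; ring

theorem primrec_const_pow (c : ℕ) {α : Type*} [Primcodable α] {f : α → ℕ}
    (hf : Primrec f) : Primrec fun a => c ^ f a := by
  have : Primrec fun n : ℕ => c ^ n := by
    refine (Primrec.nat_rec₁ 1 (f := fun _ x => c * x)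
      (Primrec.nat_mul.comp (Primrec.const c) Primrec.snd)).of_eq fun n => ?_
    induction n with
    | zero => rfl
    | succ n ih => simp only [pow_succ]; rw [← ih]; exact mul_comm _ _
  exact this.comp hf

theorem primrec_pi_of_forall {α σ : Type*} [Primcodable α] [Primcodable σ] {k : ℕ}
    {f : α → Fin k → σ} (h : ∀ i, Primrec fun a => f a i) : Primrec f := by
  exact Primrec.fin_curry.2 (Primrec₂.swap (Primrec.fin_curry₁.2 h))

end RatEncoding
end TauUndec

namespace TauUndec
section TraceCriterion

theorem prod_ofFn_apply {ι R : Type*} [Fintype ι] [DecidableEq ι] [CommRing R] (n : ℕ)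
    (N : Fin (n + 1) → Matrix ι ι R) (a b : ι) :
    (List.ofFn N).prod a b = ∑ α : Fin n → ι, ∏ k : Fin (n + 1),
      N k ((Fin.cons a α : Fin (n + 1) → ι) k) ((Fin.snoc α b : Fin (n + 1) → ι) k) := by
  induction n generalizing a with
  | zero => simp [Fin.snoc]
  | succ n ih =>
    rw [List.ofFn_succ, List.prod_cons, Matrix.mul_apply,
      ← (Fin.consEquiv fun _ => ι).sum_comp, Fintype.sum_prod_type]
    refine Finset.sum_congr rfl fun c _ => ?_
    rw [ih, Finset.mul_sum]
    refine Finset.sum_congr rfl fun α _ => ?_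
    conv_rhs => rw [Fin.prod_univ_succ]
    simp only [Fin.consEquiv, Equiv.coe_fn_mk, Fin.cons_zero, Fin.cons_succ,
      ← Fin.cons_snoc_eq_snoc_cons]

theorem sum_cyclic_eq_trace {ι R : Type*} [Fintype ι] [DecidableEq ι] [CommRing R] (n : ℕ)
    (N : Fin (n + 1) → Matrix ι ι R) :
    ∑ α : Fin (n + 1) → ι, ∏ k : Fin (n + 1), N k (α k) (α (k + 1)) =
      (List.ofFn N).prod.trace := by
  rw [← (Fin.consEquiv fun _ => ι).sum_comp, Fintype.sum_prod_type, Matrix.trace]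
  refine Finset.sum_congr rfl fun a _ => ?_
  rw [Matrix.diag_apply, prod_ofFn_apply]
  refine Finset.sum_congr rfl fun α _ => Finset.prod_congr rfl fun k _ => ?_
  congr 1
  simp only [Fin.consEquiv, Equiv.coe_fn_mk]
  induction k using Fin.lastCases with
  | last => simp
  | cast k => rw [Fin.snoc_castSucc, Fin.coeSucc_eq_succ, Fin.cons_succ]

/-- The tuple of diagonal matrices whose `i`-th diagonal entries form the matrix `M i`. -/
def diagTuple {d r : ℕ} (M : Fin d → Matrix (Fin r) (Fin r) ℚ) :
    Fin r → Fin r → Fin d → Fin d → ℚ × ℚ :=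
  fun α β i j => (if i = j then M i α β else 0, 0)

theorem tauMat_diagTuple {d r : ℕ} (M : Fin d → Matrix (Fin r) (Fin r) ℚ) (n : ℕ) :
    tauMat (fun α β => toMatC (diagTuple M α β)) n =
      Matrix.diagonal fun i => (((List.ofFn fun k => M (i k)).prod.trace : ℚ) : ℂ) := by
  ext i j
  rw [Matrix.diagonal_apply, ← sum_cyclic_eq_trace]
  simp only [tauMat, toMatC, diagTuple, Matrix.of_apply]
  split_ifs with h
  · subst h; simp
  · obtain ⟨k, hk⟩ := Function.ne_iff.1 h
    refine Finset.sum_eq_zero fun α _ => Finset.prod_eq_zero (Finset.mem_univ k) ?_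
    simp [hk]

theorem posSemidef_diagTuple_iff {d r : ℕ} (M : Fin d → Matrix (Fin r) (Fin r) ℚ) :
    (∀ n, (tauMat (fun α β => toMatC (diagTuple M α β)) n).PosSemidef) ↔
      ∀ w : List (Fin d), w ≠ [] → 0 ≤ (w.map M).prod.trace := by
  have hc : ∀ q : ℚ, (0 : ℂ) ≤ (q : ℂ) ↔ 0 ≤ q := by
    intro q
    rw [← Complex.ofReal_ratCast, Complex.zero_le_real]
    exact_mod_cast Iff.rfl
  simp only [tauMat_diagTuple, Matrix.posSemidef_diagonal_iff, hc]
  constructor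
  · intro h w hw
    obtain ⟨n, hn⟩ : ∃ n, w.length = n + 1 :=
      Nat.exists_eq_succ_of_ne_zero (by simpa using hw)
    obtain ⟨v, rfl⟩ : ∃ v : Fin (n + 1) → Fin d, w = List.ofFn v :=
      ⟨fun k => w.get (k.cast hn.symm), by
        apply List.ext_getElem <;> simp [hn, -List.ofFn_succ]⟩
    have := h n v
    rwa [List.map_ofFn]
  · intro h n i
    have := h (List.ofFn i) (by simp)
    rwa [List.map_ofFn] at this

theorem exists_prod_pad {r k : ℕ} (hk : k ≤ r) {ι : Type*}
    (B : ι → Matrix (Fin k) (Fin k) ℚ) :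
    ∃ P : ι → Matrix (Fin r) (Fin r) ℚ,
      (∀ i α β, P i α β =
        if h : α.val < k ∧ β.val < k then B i ⟨α, h.1⟩ ⟨β, h.2⟩ else 0) ∧
      ∀ w : List ι, w ≠ [] → (w.map P).prod.trace = (w.map B).prod.trace := by
  let E : Matrix (Fin r) (Fin k) ℚ := Matrix.of fun α i => if α.val = i.val then 1 else 0
  have hE : Eᵀ * E = 1 := by
    ext i j
    rw [Matrix.mul_apply, Finset.sum_eq_single (Fin.castLE hk i)]
    · simp [E, Matrix.one_apply, Fin.ext_iff]
    · intro α _ hα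
      have : ¬ α.val = i.val := fun h => hα (Fin.ext h)
      simp [E, this]
    · simp
  refine ⟨fun i => E * B i * Eᵀ, fun i α β => ?_, fun w hw => ?_⟩
  · change (E * B i * Eᵀ) α β = _
    simp only [Matrix.mul_apply, E, Matrix.of_apply, Matrix.transpose_apply, ite_mul, one_mul,
      zero_mul, mul_ite, mul_one, mul_zero]
    split_ifs with h
    · rw [Finset.sum_eq_single ⟨β, h.2⟩, Finset.sum_eq_single ⟨α, h.1⟩]
      · simp
      · intro b _ hb
        rw [if_neg]
        exact fun h' => hb (Fin.ext h'.symm)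
      · simp
      · intro b _ hb
        rw [if_neg]
        exact fun h' => hb (Fin.ext h'.symm)
      · simp
    · refine Finset.sum_eq_zero fun j _ => ?_
      split_ifs with hj
      · refine Finset.sum_eq_zero fun i _ => ?_
        rw [if_neg]
        intro hi
        exact h ⟨hi ▸ i.2, hj ▸ j.2⟩
      · rfl
  · have key : ∀ w : List ι, w ≠ [] →
        (w.map fun i => E * B i * Eᵀ).prod = E * (w.map B).prod * Eᵀ := by
      intro w
      induction w with
      | nil => simp
      | cons i w ih =>
        intro _
        by_cases hw : w = []
        · simp [hw]
        · rw [List.map_cons, List.prod_cons, ih hw, List.map_cons, List.prod_cons]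
          calc E * B i * Eᵀ * (E * (w.map B).prod * Eᵀ)
              = E * B i * (Eᵀ * E) * (w.map B).prod * Eᵀ := by simp only [Matrix.mul_assoc]
            _ = _ := by rw [hE]; simp only [Matrix.mul_assoc, Matrix.mul_one]
    rw [key w hw, Matrix.trace_mul_comm, ← Matrix.mul_assoc, hE, Matrix.one_mul]

/-- Lower triangular matrices with nonnegative diagonal. -/
def LowerNonneg {k : ℕ} (A : Matrix (Fin k) (Fin k) ℚ) : Prop :=
  (∀ i j, i < j → A i j = 0) ∧ ∀ i, 0 ≤ A i i

theorem LowerNonneg.mul {k : ℕ} {A B : Matrix (Fin k) (Fin k) ℚ} (hA : LowerNonneg A)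
    (hB : LowerNonneg B) : LowerNonneg (A * B) := by
  constructor
  · intro i j hij
    rw [Matrix.mul_apply]
    refine Finset.sum_eq_zero fun l _ => ?_
    rcases lt_or_ge i l with h | h
    · rw [hA.1 i l h, zero_mul]
    · rw [hB.1 l j (h.trans_lt hij), mul_zero]
  · intro i
    rw [Matrix.mul_apply, Finset.sum_eq_single i]
    · exact mul_nonneg (hA.2 i) (hB.2 i)
    · intro l _ hl
      rcases lt_or_gt_of_ne hl with h | h
      · rw [hB.1 l i h, mul_zero]
      · rw [hA.1 i l h, zero_mul]
    · simp

theorem lowerNonneg_prod {k : ℕ} {l : List (Matrix (Fin k) (Fin k) ℚ)}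
    (h : ∀ A ∈ l, LowerNonneg A) : LowerNonneg l.prod := by
  induction l with
  | nil =>
    refine ⟨fun i j hij => ?_, fun i => ?_⟩
    · simp [hij.ne]
    · simp
  | cons A l ih =>
    rw [List.prod_cons]
    exact (h A (by simp)).mul (ih fun B hB => h B (by simp [hB]))

theorem dotProduct_prod_nonneg {k : ℕ} {ι : Type*} (A : ι → Matrix (Fin k) (Fin k) ℚ)
    (f g : Fin k → ℚ) (hfg : ∀ ws : List ι, 0 ≤ f ⬝ᵥ (ws.map A).prod *ᵥ g)
    (n : ℕ) (l : List (Matrix (Fin k) (Fin k) ℚ)) (hn : l.length ≤ n)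
    (hl : ∀ B ∈ l, B ∈ Set.range A ∨ B = vecMulVec g f ∨ B = 0) :
    0 ≤ f ⬝ᵥ l.prod *ᵥ g := by
  induction n generalizing l with
  | zero =>
    have : l = [] := by simpa using hn
    simpa [this] using hfg []
  | succ n ih =>
    by_cases h0 : (0 : Matrix (Fin k) (Fin k) ℚ) ∈ l
    · rw [List.prod_eq_zero h0]; simp
    by_cases hS : vecMulVec g f ∈ l
    · obtain ⟨l₁, l₂, rfl⟩ := List.append_of_mem hS
      have h1 := ih l₁ (by simp at hn; omega) fun B hB => hl B (by simp [hB])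
      have h2 := ih l₂ (by simp at hn; omega) fun B hB => hl B (by simp [hB])
      rw [List.prod_append, List.prod_cons, ← Matrix.mulVec_mulVec, ← Matrix.mulVec_mulVec,
        Matrix.vecMulVec_mulVec]
      rw [Matrix.mulVec_smul, dotProduct_smul]
      simpa using mul_nonneg h1 h2
    · have : ∀ B ∈ l, B ∈ Set.range A := fun B hB => by
        rcases hl B hB with h | rfl | rfl
        · exact h
        · exact absurd hB hS
        · exact absurd hB h0
      obtain ⟨ws, rfl⟩ : ∃ ws : List ι, ws.map A = l := by
        change l ∈ Set.range (List.map A)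
        rw [Set.range_list_map]
        exact this
      exact hfg ws

theorem trace_prod_nonneg {k : ℕ} {ι : Type*} (A : ι → Matrix (Fin k) (Fin k) ℚ)
    (hA : ∀ i, LowerNonneg (A i))
    (f g : Fin k → ℚ) (hfg : ∀ ws : List ι, 0 ≤ f ⬝ᵥ (ws.map A).prod *ᵥ g)
    (l : List (Matrix (Fin k) (Fin k) ℚ))
    (hl : ∀ B ∈ l, B ∈ Set.range A ∨ B = vecMulVec g f ∨ B = 0) :
    0 ≤ l.prod.trace := by
  by_cases hS : vecMulVec g f ∈ l
  · obtain ⟨l₁, l₂, rfl⟩ := List.append_of_mem hS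
    rw [List.prod_append, List.prod_cons, Matrix.trace_mul_comm, Matrix.mul_assoc,
      ← List.prod_append, Matrix.vecMulVec_mul, Matrix.trace_vecMulVec, dotProduct_comm,
      ← Matrix.dotProduct_mulVec]
    exact dotProduct_prod_nonneg A f g hfg _ _ le_rfl fun B hB => hl B (by
      rcases List.mem_append.1 hB with h | h <;> simp [h])
  · refine Finset.sum_nonneg fun i _ => (lowerNonneg_prod fun B hB => ?_).2 i
    rcases hl B hB with ⟨j, rfl⟩ | rfl | rfl
    · exact hA j
    · exact absurd hB hS
    · exact ⟨fun _ _ _ => rfl, fun _ => le_rfl⟩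

/-- The letters `A 0, …, A 4`, followed by `vecMulVec g f` and by zero matrices. -/
def letters {k : ℕ} (d : ℕ) (A : Fin 5 → Matrix (Fin k) (Fin k) ℚ) (f g : Fin k → ℚ)
    (i : Fin d) : Matrix (Fin k) (Fin k) ℚ :=
  if h : i.val < 5 then A ⟨i, h⟩ else if i.val = 5 then vecMulVec g f else 0

theorem trace_letters_nonneg_iff {k d : ℕ} (hd : 6 ≤ d) (A : Fin 5 → Matrix (Fin k) (Fin k) ℚ)
    (hA : ∀ i, LowerNonneg (A i)) (f g : Fin k → ℚ) :
    (∀ w : List (Fin d), w ≠ [] → 0 ≤ (w.map (letters d A f g)).prod.trace) ↔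
      ∀ ws : List (Fin 5), 0 ≤ f ⬝ᵥ (ws.map A).prod *ᵥ g := by
  constructor
  · intro h ws
    have := h (⟨5, by omega⟩ :: ws.map (Fin.castLE (by omega))) (by simp)
    rw [List.map_cons, List.prod_cons, List.map_map] at this
    have hc : letters d A f g ∘ Fin.castLE (by omega) = A := by
      funext i
      simp [letters]
    have h5 : letters d A f g ⟨5, by omega⟩ = vecMulVec g f := by simp [letters]
    rwa [hc, h5, Matrix.vecMulVec_mul, Matrix.trace_vecMulVec, dotProduct_comm,
      ← Matrix.dotProduct_mulVec] at this
  · intro h w _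
    refine trace_prod_nonneg A hA f g h _ fun B hB => ?_
    obtain ⟨i, -, rfl⟩ := List.mem_map.1 hB
    unfold letters
    split_ifs
    · exact Or.inl ⟨_, rfl⟩
    · exact Or.inr (Or.inl rfl)
    · exact Or.inr (Or.inr rfl)

end TraceCriterion
end TauUndec

namespace TauUndec
section BitQueue

/-- A signal of period `2 * m` taking the value `1` at multiples of the period, the value `3`
one step later, and `0` elsewhere. -/
def clock (m t : ℕ) : ℕ :=
  if t % (2 * m) = 0 then 1 else if t % (2 * m) = 1 then 3 else 0

/-- The word appended to the bit queue when the sum of the clock and of the bit read is `v`. -/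
def pushWord (X : List Bool) (v : ℕ) : List Bool :=
  if v = 2 then X else if v = 4 then [false, false] else []

/-- The content at time `t` of the bit queue that starts with `q`. -/
def bitQueue (m : ℕ) (X q : List Bool) : ℕ → List Bool
  | 0 => q
  | t + 1 => match bitQueue m X q t with
    | [] => []
    | b :: q' => q' ++ pushWord X (clock m t + b.toNat)

/-- A bit word read as digits after the point in base `100`. -/
def num : List Bool → ℚ
  | [] => 0
  | b :: q => (b.toNat + num q) / 100

theorem num_append (q w : List Bool) : num (q ++ w) = num q + num w / 100 ^ q.length := by
  induction q with
  | nil => simp [num]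
  | cons b q ih =>
    simp only [List.cons_append, num, ih, List.length_cons, pow_succ]
    field_simp
    ring

theorem num_nonneg (q : List Bool) : 0 ≤ num q := by
  induction q with
  | nil => simp [num]
  | cons b q ih => simp only [num]; positivity

theorem num_add_le (q : List Bool) : num q + 1 / 2 / 100 ^ q.length ≤ 1 / 2 := by
  induction q with
  | nil => simp [num]
  | cons b q ih =>
    have hb : (b.toNat : ℚ) ≤ 1 := by exact_mod_cast Bool.toNat_le b
    have : num (b :: q) + 1 / 2 / 100 ^ (b :: q).length =
        (b.toNat + (num q + 1 / 2 / 100 ^ q.length)) / 100 := by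
      simp only [num, List.length_cons, pow_succ]
      field_simp
      ring
    rw [this]
    linarith

/-- The periodic continuation of the clock from time `t` on, read in base `100`. -/
def tailValue (m t : ℕ) : ℚ :=
  (∑ i ∈ Finset.range (2 * m), (clock m (t + i) : ℚ) * 100 ^ (2 * m - 1 - i)) /
    (100 ^ (2 * m) - 1)

theorem clock_add_period (m t : ℕ) : clock m (t + 2 * m) = clock m t := by
  simp [clock]

theorem clock_le (m t : ℕ) : clock m t ≤ 3 := by
  unfold clock; split_ifs <;> simp

theorem hundred_pow_sub_one_pos {m : ℕ} (hm : 0 < m) : (0 : ℚ) < 100 ^ m - 1 := by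
  have : (1 : ℚ) < 100 ^ m := one_lt_pow₀ (by norm_num) hm.ne'
  linarith

theorem tailValue_succ {m : ℕ} (hm : 0 < m) (t : ℕ) :
    tailValue m (t + 1) = 100 * tailValue m t - clock m t := by
  have hpos := hundred_pow_sub_one_pos (m := 2 * m) (by omega)
  have h1 : ∑ i ∈ Finset.range (2 * m + 1), (clock m (t + i) : ℚ) * 100 ^ (2 * m - i) =
      100 * (∑ i ∈ Finset.range (2 * m), (clock m (t + i) : ℚ) * 100 ^ (2 * m - 1 - i)) +
        clock m t := by
    rw [Finset.sum_range_succ, Finset.mul_sum, clock_add_period, Nat.sub_self, pow_zero, mul_one]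
    congr 1
    refine Finset.sum_congr rfl fun i hi => ?_
    have hi := Finset.mem_range.1 hi
    obtain ⟨e, he⟩ : ∃ e, 2 * m - i = e + 1 := ⟨2 * m - i - 1, by omega⟩
    rw [he, show 2 * m - 1 - i = e by omega]
    ring
  have h2 : ∑ i ∈ Finset.range (2 * m + 1), (clock m (t + i) : ℚ) * 100 ^ (2 * m - i) =
      (∑ i ∈ Finset.range (2 * m), (clock m (t + 1 + i) : ℚ) * 100 ^ (2 * m - 1 - i)) +
        clock m t * 100 ^ (2 * m) := by
    rw [Finset.sum_range_succ']
    congr 1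
    refine Finset.sum_congr rfl fun i _ => ?_
    rw [show t + (i + 1) = t + 1 + i by ring, show 2 * m - (i + 1) = 2 * m - 1 - i by omega]
  unfold tailValue
  rw [div_eq_iff hpos.ne', sub_mul, mul_assoc, div_mul_cancel₀ _ hpos.ne']
  linarith

theorem tailValue_nonneg {m : ℕ} (hm : 0 < m) (t : ℕ) : 0 ≤ tailValue m t :=
  div_nonneg (Finset.sum_nonneg fun _ _ => by positivity)
    (hundred_pow_sub_one_pos (by omega)).le

theorem tailValue_le {m : ℕ} (hm : 0 < m) (t : ℕ) : tailValue m t ≤ 1 / 33 := by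
  have hpos := hundred_pow_sub_one_pos (m := 2 * m) (by omega)
  unfold tailValue
  rw [div_le_iff₀ hpos]
  have h1 : ∑ i ∈ Finset.range (2 * m), (clock m (t + i) : ℚ) * 100 ^ (2 * m - 1 - i) ≤
      ∑ i ∈ Finset.range (2 * m), (3 : ℚ) * 100 ^ (2 * m - 1 - i) := by
    refine Finset.sum_le_sum fun i _ => ?_
    have : (clock m (t + i) : ℚ) ≤ 3 := by exact_mod_cast clock_le m (t + i)
    gcongr
  rw [Finset.sum_range_reflect (fun i => (3 : ℚ) * 100 ^ i) (2 * m), ← Finset.mul_sum,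
    geom_sum_eq (by norm_num)] at h1
  linarith

/-- The affine action of the letter `v` on pairs (queue content, weight of the queue end). -/
def gen (X : List Bool) (v : Fin 5) (p : ℚ × ℚ) : ℚ × ℚ :=
  (100 * p.1 - (v.val : ℚ) + 100 * p.2 * num (pushWord X v),
    100 / 100 ^ (pushWord X v).length * p.2)

/-- The pair describing the bit queue `q` at time `t`. -/
def trueState (m t : ℕ) (q : List Bool) : ℚ × ℚ :=
  (num q + tailValue m t, 1 / 100 ^ q.length)

theorem clock_add_lt (m t : ℕ) (b : Bool) : clock m t + b.toNat < 5 := by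
  have := clock_le m t
  have := Bool.toNat_le b
  omega

theorem gen_trueState {m : ℕ} (hm : 0 < m) (X : List Bool) (t : ℕ) (b : Bool) (q : List Bool) :
    gen X ⟨clock m t + b.toNat, clock_add_lt m t b⟩ (trueState m t (b :: q)) =
      trueState m (t + 1) (q ++ pushWord X (clock m t + b.toNat)) := by
  simp only [gen, trueState, num_append, num, tailValue_succ hm, List.length_append,
    List.length_cons, pow_succ, pow_add, Prod.mk.injEq]
  constructor
  · push_cast
    field_simp
    ring
  · field_simp

theorem gen_lt_of_lt {m : ℕ} (hm : 0 < m) (X : List Bool) (t : ℕ) (b : Bool) (q : List Bool)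
    (v : Fin 5) (hv : v.val < clock m t + b.toNat) :
    1 / 2 < (gen X v (trueState m t (b :: q))).1 := by
  have h1 : (v.val : ℚ) + 1 ≤ clock m t + b.toNat := by exact_mod_cast hv
  have h2 := num_nonneg q
  have h3 : 0 ≤ 1 / 100 ^ (b :: q).length * num (pushWord X v) :=
    mul_nonneg (by positivity) (num_nonneg _)
  have h4 := tailValue_nonneg hm (t + 1)
  rw [tailValue_succ hm] at h4
  simp only [gen, trueState, num]
  linarith

theorem gen_neg_of_gt {m : ℕ} (hm : 0 < m) (X : List Bool) (t : ℕ) (b : Bool) (q : List Bool)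
    (v : Fin 5) (hv : clock m t + b.toNat < v.val) :
    (gen X v (trueState m t (b :: q))).1 + (gen X v (trueState m t (b :: q))).2 / 2 < 0 := by
  have h1 : (clock m t : ℚ) + b.toNat + 1 ≤ v.val := by exact_mod_cast hv
  have h2 := num_add_le q
  have h3 := mul_le_mul_of_nonneg_left (num_add_le (pushWord X v))
    (show (0 : ℚ) ≤ 1 / 100 ^ q.length by positivity)
  have h4 := tailValue_le hm (t + 1)
  rw [tailValue_succ hm] at h4
  have h5 : (1 : ℚ) / 100 ^ (b :: q).length = 1 / 100 ^ q.length / 100 := by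
    rw [List.length_cons, pow_succ]; field_simp
  have h6 : (1 : ℚ) / 2 / 100 ^ q.length = 1 / 100 ^ q.length / 2 := by ring
  simp only [gen, trueState, num, h5]
  rw [h6] at h2
  generalize (1 : ℚ) / 100 ^ q.length = s at *
  have h7 : (100 : ℚ) / 100 ^ (pushWord X v).length * (s / 100) / 2 =
      s * (1 / 2 / 100 ^ (pushWord X v).length) := by ring
  rw [h7]
  linarith

theorem fst_le_of_gen {X : List Bool} {v : Fin 5} {p : ℚ × ℚ} (hs : 0 ≤ p.2)
    (h : (gen X v p).1 ≤ 1 / 2) : p.1 ≤ 1 / 2 := by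
  have h1 : (v.val : ℚ) ≤ 4 := by exact_mod_cast Nat.le_of_lt_succ v.2
  have h2 := mul_nonneg hs (num_nonneg (pushWord X v))
  simp only [gen] at h
  linarith

theorem add_nonneg_of_gen {X : List Bool} {v : Fin 5} {p : ℚ × ℚ} (hs : 0 ≤ p.2)
    (h : 0 ≤ (gen X v p).1 + (gen X v p).2 / 2) : 0 ≤ p.1 + p.2 / 2 := by
  have h1 : (0 : ℚ) ≤ v.val := by positivity
  have h2 := mul_le_mul_of_nonneg_left (num_add_le (pushWord X v)) hs
  simp only [gen] at h
  have h7 : (100 : ℚ) / 100 ^ (pushWord X v).length * p.2 / 2 =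
      100 * (p.2 * (1 / 2 / 100 ^ (pushWord X v).length)) := by ring
  rw [h7] at h
  linarith

theorem foldr_gen_snd_nonneg (X : List Bool) (p : ℚ × ℚ) (hp : 0 ≤ p.2) (ws : List (Fin 5)) :
    0 ≤ (ws.foldr (gen X) p).2 := by
  induction ws with
  | nil => exact hp
  | cons v ws ih => exact mul_nonneg (by positivity) ih

theorem foldr_gen_eq_trueState {m : ℕ} (hm : 0 < m) (X q : List Bool)
    (hq : ∀ t, bitQueue m X q t ≠ []) (ws : List (Fin 5))
    (h1 : (ws.foldr (gen X) (trueState m 0 q)).1 ≤ 1 / 2)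
    (h2 : 0 ≤ (ws.foldr (gen X) (trueState m 0 q)).1 +
      (ws.foldr (gen X) (trueState m 0 q)).2 / 2) :
    ws.foldr (gen X) (trueState m 0 q) = trueState m ws.length (bitQueue m X q ws.length) := by
  induction ws with
  | nil => rfl
  | cons v ws ih =>
    have hs := foldr_gen_snd_nonneg X (trueState m 0 q)
      (by simp only [trueState]; positivity) ws
    rw [List.foldr_cons] at h1 h2 ⊢
    have ih' := ih (fst_le_of_gen hs h1) (add_nonneg_of_gen hs h2)
    rw [ih'] at h1 h2 ⊢
    rw [List.length_cons, bitQueue]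
    have hne := hq ws.length
    generalize ws.length = t at *
    generalize bitQueue m X q t = Q at *
    cases Q with
    | nil => exact absurd rfl hne
    | cons b Q =>
      rcases lt_trichotomy v.val (clock m t + b.toNat) with h | h | h
      · exact absurd (gen_lt_of_lt hm X t b Q v h) (not_lt.2 h1)
      · rw [← gen_trueState hm]
        congr 1
        exact Fin.ext h
      · exact absurd (gen_neg_of_gt hm X t b Q v h) (not_lt.2 h2)

/-- The quadratic polynomial that tests whether a pair is close to `(0, 1)`. -/
def testPoly (p : ℚ × ℚ) : ℚ := 8 - 18 * p.2 + 9 * p.2 ^ 2 + 9 * p.1 ^ 2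

theorem testPoly_nonneg_iff {m : ℕ} (hm : 0 < m) (X q : List Bool) :
    (∀ ws : List (Fin 5), 0 ≤ testPoly (ws.foldr (gen X) (trueState m 0 q))) ↔
      ∀ t, bitQueue m X q t ≠ [] := by
  constructor
  · intro h t
    induction t using Nat.strong_induction_on with
    | _ t ih =>
    intro ht
    have key : ∀ u ≤ t, ∃ ws : List (Fin 5),
        ws.foldr (gen X) (trueState m 0 q) = trueState m u (bitQueue m X q u) := by
      intro u
      induction u with
      | zero => exact fun _ => ⟨[], rfl⟩
      | succ u ihu =>
        intro hu
        obtain ⟨ws, hws⟩ := ihu (by omega)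
        have hne := ih u (by omega)
        rw [bitQueue]
        generalize bitQueue m X q u = Q at *
        cases Q with
        | nil => exact absurd rfl hne
        | cons b Q =>
          exact ⟨⟨clock m u + b.toNat, clock_add_lt m u b⟩ :: ws, by
            rw [List.foldr_cons, hws, gen_trueState hm]⟩
    obtain ⟨ws, hws⟩ := key t le_rfl
    have := h ws
    rw [hws, ht] at this
    simp only [testPoly, trueState, num, List.length_nil, pow_zero, div_one, zero_add] at this
    have h1 := tailValue_nonneg hm t
    have h2 := tailValue_le hm t
    nlinarith
  · intro hq ws
    by_contra hneg
    have hs := foldr_gen_snd_nonneg X (trueState m 0 q)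
      (by simp only [trueState]; positivity) ws
    have heq := foldr_gen_eq_trueState hm X q hq ws
    have hne := hq ws.length
    unfold testPoly at hneg
    set p := ws.foldr (gen X) (trueState m 0 q) with hp
    have h1 : 9 * (p.2 - 1) ^ 2 + 9 * p.1 ^ 2 < 1 := by nlinarith
    have h2 : p.1 < 1 / 3 := by nlinarith [sq_nonneg (p.2 - 1)]
    have h3 : -(1 / 3) < p.1 := by nlinarith [sq_nonneg (p.2 - 1)]
    have h4 : 2 / 3 < p.2 := by nlinarith [sq_nonneg p.1]
    have heq := heq (by linarith) (by linarith)
    rw [heq] at h4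
    simp only [trueState] at h4
    obtain ⟨e, he⟩ := Nat.exists_eq_succ_of_ne_zero
      (fun h => hne (List.length_eq_zero_iff.1 h))
    rw [he, pow_succ] at h4
    have : (1 : ℚ) / (100 ^ e * 100) ≤ 1 / 100 := by
      apply one_div_le_one_div_of_le (by norm_num)
      have : (1 : ℚ) ≤ 100 ^ e := one_le_pow₀ (by norm_num)
      linarith
    linarith

/-- The monomials of degree at most two in the two coordinates of a pair. -/
def monomials (p : ℚ × ℚ) : Fin 6 → ℚ :=
  ![1, p.2, p.2 ^ 2, p.1, p.1 * p.2, p.1 ^ 2]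

/-- The action of `gen X v` on monomials. -/
def genMatrix (X : List Bool) (v : Fin 5) : Matrix (Fin 6) (Fin 6) ℚ :=
  let k : ℚ := 100 / 100 ^ (pushWord X v).length
  let c : ℚ := 100 * num (pushWord X v)
  let x : ℚ := v.val
  !![1, 0, 0, 0, 0, 0;
     0, k, 0, 0, 0, 0;
     0, 0, k ^ 2, 0, 0, 0;
     -x, c, 0, 100, 0, 0;
     0, -(k * x), k * c, 0, 100 * k, 0;
     x ^ 2, -(2 * x * c), c ^ 2, -(200 * x), 200 * c, 10000]

theorem genMatrix_mulVec (X : List Bool) (v : Fin 5) (p : ℚ × ℚ) :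
    genMatrix X v *ᵥ monomials p = monomials (gen X v p) := by
  unfold genMatrix monomials gen
  simp only
  generalize (100 : ℚ) / 100 ^ (pushWord X v).length = k
  generalize num (pushWord X v) = c
  generalize (v.val : ℚ) = x
  ext i
  fin_cases i <;> simp [Matrix.mulVec, dotProduct, Fin.sum_univ_succ] <;> ring

theorem lowerNonneg_genMatrix (X : List Bool) (v : Fin 5) : LowerNonneg (genMatrix X v) := by
  have hk : (0 : ℚ) ≤ 100 / 100 ^ (pushWord X v).length := by positivity
  unfold genMatrix
  simp only
  generalize (100 : ℚ) / 100 ^ (pushWord X v).length = k at *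
  generalize num (pushWord X v) = c
  generalize (v.val : ℚ) = x
  constructor
  · intro i j hij
    fin_cases i <;> fin_cases j <;> first | rfl | exact absurd hij (by decide)
  · intro i
    fin_cases i <;> simp <;> positivity

theorem prod_genMatrix_mulVec (X : List Bool) (ws : List (Fin 5)) (p : ℚ × ℚ) :
    (ws.map (genMatrix X)).prod *ᵥ monomials p = monomials (ws.foldr (gen X) p) := by
  induction ws with
  | nil => simp
  | cons v ws ih =>
    rw [List.map_cons, List.prod_cons, ← Matrix.mulVec_mulVec, ih, genMatrix_mulVec,
      List.foldr_cons]

/-- The coefficients of `testPoly`. -/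
def testCoeff : Fin 6 → ℤ := ![8, -18, 9, 0, 0, 9]

theorem testCoeff_dotProduct (p : ℚ × ℚ) :
    (fun i => (testCoeff i : ℚ)) ⬝ᵥ monomials p = testPoly p := by
  simp [dotProduct, Fin.sum_univ_succ, testCoeff, monomials, testPoly]
  ring

theorem num_flatten_replicate (X : List Bool) (hX : X ≠ []) (N : ℕ) :
    num (List.replicate N X).flatten =
      num X * 100 ^ X.length / (100 ^ X.length - 1) * (1 - 1 / 100 ^ (X.length * N)) := by
  have hpos := hundred_pow_sub_one_pos (List.length_pos_iff.2 hX)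
  induction N with
  | zero => simp [num]
  | succ N ih =>
    rw [List.replicate_succ, List.flatten_cons, num_append, ih, Nat.mul_succ, pow_add]
    have h100 : (0 : ℚ) < 100 ^ X.length := by positivity
    generalize (100 : ℚ) ^ X.length = u at *
    have := hpos.ne'
    field_simp
    ring

/-- An integral multiple of the vector of monomials of the initial state. -/
def initVec (a b D L N : ℕ) : Fin 6 → ℕ :=
  let U := D * 100 ^ (L * N)
  let V := a * 100 ^ (L * N) + b * (100 ^ (L * N) - 1)
  ![U ^ 2, D * U, D ^ 2, U * V, D * V, V ^ 2]

theorem exists_initVec {m : ℕ} (hm : 0 < m) (X : List Bool) (hX : X ≠ []) :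
    ∃ a b D : ℕ, ∀ N : ℕ, ∃ c : ℚ, 0 < c ∧
      (fun i => (initVec a b D X.length N i : ℚ)) =
        c • monomials (trueState m 0 (List.replicate N X).flatten) := by
  obtain ⟨x, hx⟩ : ∃ x : ℚ, x = tailValue m 0 := ⟨_, rfl⟩
  obtain ⟨z, hz⟩ : ∃ z : ℚ, z = num X * 100 ^ X.length / (100 ^ X.length - 1) := ⟨_, rfl⟩
  have hx0 : 0 ≤ x := hx ▸ tailValue_nonneg hm 0
  have hz0 : 0 ≤ z := hz ▸ div_nonneg (mul_nonneg (num_nonneg X) (by positivity))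
    (hundred_pow_sub_one_pos (List.length_pos_iff.2 hX)).le
  have hxq : (x.num.natAbs : ℚ) = x * x.den := by
    rw [Rat.mul_den_eq_num, Nat.cast_natAbs, abs_of_nonneg (Rat.num_nonneg.2 hx0)]
  have hzq : (z.num.natAbs : ℚ) = z * z.den := by
    rw [Rat.mul_den_eq_num, Nat.cast_natAbs, abs_of_nonneg (Rat.num_nonneg.2 hz0)]
  refine ⟨x.num.natAbs * z.den, z.num.natAbs * x.den, x.den * z.den, fun N =>
    ⟨(x.den * z.den * 100 ^ (X.length * N)) ^ 2, ?_, ?_⟩⟩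
  · have := x.den_pos
    have := z.den_pos
    positivity
  · have hlen : (List.replicate N X).flatten.length = X.length * N := by
      simp [mul_comm]
    have hT : 1 ≤ 100 ^ (X.length * N) := Nat.one_le_pow _ _ (by norm_num)
    have hT0 : (100 : ℚ) ^ (X.length * N) ≠ 0 := by positivity
    ext i
    simp only [trueState, num_flatten_replicate X hX, hlen, ← hz, ← hx, initVec, monomials,
      Pi.smul_apply, smul_eq_mul]
    generalize x.num.natAbs = nx at *
    generalize z.num.natAbs = nz at *
    generalize x.den = dx at *
    generalize z.den = dz at *
    fin_cases i <;> simp [Nat.cast_sub hT, hxq, hzq] <;> field_simp <;> ring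
end BitQueue
end TauUndec

namespace TauUndec
section Reduction

/-- The tuple of diagonal matrices attached to the tag word `X` repeated `N` times. -/
theorem exists_primrec_tuple {d r m : ℕ} (hd : 6 ≤ d) (hr : 6 ≤ r) (hm : 0 < m) (X : List Bool)
    (hX : X ≠ []) (e : ℕ → ℕ) (he : Primrec e) :
    ∃ ρ : ℕ → Fin r → Fin r → Fin d → Fin d → ℚ × ℚ, Primrec ρ ∧
      ∀ n, (∀ k, (tauMat (fun α β => toMatC (ρ n α β)) k).PosSemidef) ↔
        ∀ t, bitQueue m X (List.replicate (e n) X).flatten t ≠ [] := by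
  obtain ⟨a, b, D, hinit⟩ := exists_initVec hm X hX
  let f : Fin 6 → ℚ := fun i => (testCoeff i : ℚ)
  let g : ℕ → Fin 6 → ℚ := fun n i => (initVec a b D X.length (e n) i : ℚ)
  choose P hP hPtr using fun n => exists_prod_pad hr (letters d (genMatrix X) f (g n))
  refine ⟨fun n => diagTuple (P n), ?_, fun n => ?_⟩
  · refine primrec_pi_of_forall fun α => primrec_pi_of_forall fun β =>
      primrec_pi_of_forall fun i => primrec_pi_of_forall fun j => ?_
    refine Primrec.pair ?_ (Primrec.const 0)
    by_cases hij : i = j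
    · simp only [if_pos hij, hP]
      split_ifs with hαβ
      · unfold letters
        split_ifs
        · exact Primrec.const _
        · have hpow : Primrec fun n => 100 ^ (X.length * e n) :=
            primrec_const_pow 100 (Primrec.nat_mul.comp (Primrec.const _) he)
          have hU : Primrec fun n => D * 100 ^ (X.length * e n) :=
            Primrec.nat_mul.comp (Primrec.const D) hpow
          have hV : Primrec fun n => a * 100 ^ (X.length * e n) +
              b * (100 ^ (X.length * e n) - 1) :=
            Primrec.nat_add.comp (Primrec.nat_mul.comp (Primrec.const a) hpow)
              (Primrec.nat_mul.comp (Primrec.const b)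
                (Primrec.nat_sub.comp hpow (Primrec.const 1)))
          have hg : ∀ i, Primrec fun n => initVec a b D X.length (e n) i := by
            intro i
            fin_cases i
            · exact (Primrec.nat_mul.comp hU hU).of_eq fun n => (sq _).symm
            · exact Primrec.nat_mul.comp (Primrec.const D) hU
            · exact Primrec.const (D ^ 2)
            · exact Primrec.nat_mul.comp hU hV
            · exact Primrec.nat_mul.comp (Primrec.const D) hV
            · exact (Primrec.nat_mul.comp hV hV).of_eq fun n => (sq _).symm
          refine (primrec_intCast_mul_natCast_rat (testCoeff ⟨β, hαβ.2⟩)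
            (hg ⟨α, hαβ.1⟩)).of_eq fun n => ?_
          rw [Matrix.vecMulVec_apply, mul_comm]
        · exact Primrec.const _
      · exact Primrec.const _
    · simp only [if_neg hij]
      exact Primrec.const _
  · rw [posSemidef_diagTuple_iff, ← testPoly_nonneg_iff hm]
    have h1 : (∀ w : List (Fin d), w ≠ [] → 0 ≤ (w.map (P n)).prod.trace) ↔
        ∀ w : List (Fin d), w ≠ [] →
          0 ≤ (w.map (letters d (genMatrix X) f (g n))).prod.trace :=
      forall_congr' fun w => forall_congr' fun hw => by rw [hPtr n w hw]
    rw [h1, trace_letters_nonneg_iff hd _ (lowerNonneg_genMatrix X)]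
    refine forall_congr' fun ws => ?_
    obtain ⟨c, hc, hg⟩ := hinit (e n)
    have hg' : g n = c • monomials (trueState m 0 (List.replicate (e n) X).flatten) := hg
    rw [hg', Matrix.mulVec_smul, prod_genMatrix_mulVec, dotProduct_smul, smul_eq_mul,
      testCoeff_dotProduct, mul_nonneg_iff_of_pos_left hc]

theorem not_computablePred_of_bitQueue {d r m : ℕ} (hd : 6 ≤ d) (hr : 6 ≤ r) (hm : 0 < m)
    (X : List Bool) (hX : X ≠ []) (e : ℕ → ℕ) (he : Primrec e) (K : ℕ → Prop)
    (hK : ¬ ComputablePred K)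
    (hKe : ∀ n, K n ↔ ∃ t, bitQueue m X (List.replicate (e n) X).flatten t = []) :
    ¬ ComputablePred (fun ρ : Fin r → Fin r → Fin d → Fin d → ℚ × ℚ =>
      ∀ n : ℕ, (tauMat (fun α β => toMatC (ρ α β)) n).PosSemidef) := by
  intro h
  obtain ⟨ρ, hρ, hρe⟩ := exists_primrec_tuple hd hr hm X hX e he
  refine hK (ComputablePred.of_eq (ComputablePred.computable_of_manyOneReducible
    (p := fun n => ¬ K n) ⟨ρ, hρ.to_comp, fun n => ?_⟩ h).not fun n => not_not)
  rw [hρe]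
  change ¬ K n ↔ _
  rw [hKe, not_exists]

end Reduction
end TauUndec

namespace TauUndec
section TokenQueue

/-- One step of the token machine: the token `false` increases the phase, the token `true`
appends the word attached to the current phase. -/
def tokStep (e : ℕ → List Bool) : ℕ × List Bool → ℕ × List Bool
  | (φ, []) => (φ, [])
  | (φ, false :: q) => (φ + 1, q)
  | (φ, true :: q) => (φ, q ++ e φ)

/-- The word appended to the bit queue while the word `w` is read from time `t` on. -/
def bitOutput (m : ℕ) (X : List Bool) : ℕ → List Bool → List Bool
  | _, [] => []
  | t, b :: w => pushWord X (clock m t + b.toNat) ++ bitOutput m X (t + 1) w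

theorem bitQueue_add_length (m : ℕ) (X q₀ : List Bool) (t : ℕ) (w q : List Bool)
    (h : bitQueue m X q₀ t = w ++ q) :
    bitQueue m X q₀ (t + w.length) = q ++ bitOutput m X t w := by
  induction w generalizing t q with
  | nil => simpa [bitOutput] using h
  | cons b w ih =>
    have h1 : bitQueue m X q₀ (t + 1) = w ++ (q ++ pushWord X (clock m t + b.toNat)) := by
      rw [bitQueue, h]
      simp
    have := ih (t + 1) _ h1
    rw [List.length_cons, show t + (w.length + 1) = t + 1 + w.length by ring, this, bitOutput]
    simp

theorem bitOutput_append (m : ℕ) (X : List Bool) (t : ℕ) (w w' : List Bool) :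
    bitOutput m X t (w ++ w') = bitOutput m X t w ++ bitOutput m X (t + w.length) w' := by
  induction w generalizing t with
  | nil => simp [bitOutput]
  | cons b w ih =>
    simp only [List.cons_append, bitOutput, ih, List.append_assoc, List.length_cons]
    rw [show t + 1 + w.length = t + (w.length + 1) by ring]

theorem clock_congr {m t t' : ℕ} (h : t ≡ t' [MOD 2 * m]) : clock m t = clock m t' := by
  unfold clock
  rw [show t % (2 * m) = t' % (2 * m) from h]

theorem bitOutput_congr {m t t' : ℕ} (X : List Bool) (h : t ≡ t' [MOD 2 * m]) (w : List Bool) :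
    bitOutput m X t w = bitOutput m X t' w := by
  induction w generalizing t t' with
  | nil => rfl
  | cons b w ih => rw [bitOutput, bitOutput, clock_congr h, ih (h.add_right 1)]

theorem clock_two_mul {m : ℕ} (hm : 0 < m) (j : ℕ) :
    clock m (2 * j) = if m ∣ j then 1 else 0 := by
  unfold clock
  simp only [Nat.mul_mod_mul_left, Nat.dvd_iff_mod_eq_zero]
  have : j % m < m := Nat.mod_lt _ hm
  split_ifs <;> omega

theorem clock_two_mul_add_one {m : ℕ} (hm : 0 < m) (j : ℕ) :
    clock m (2 * j + 1) = if m ∣ j then 3 else 0 := by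
  have h1 : (2 * j + 1) % (2 * m) = 2 * (j % m) + 1 := by
    have h2 : 2 * j + 1 = 2 * (j % m) + 1 + 2 * m * (j / m) := by
      have := Nat.mod_add_div j m
      nlinarith
    have : j % m < m := Nat.mod_lt _ hm
    rw [h2, Nat.add_mul_mod_self_left, Nat.mod_eq_of_lt (by omega)]
  unfold clock
  simp only [h1, Nat.dvd_iff_mod_eq_zero]
  split_ifs <;> simp_all

/-- The bit word of a token, when `X` is the word of the token `true`. -/
def tokWord (X : List Bool) (b : Bool) : List Bool := if b then X else [false, false]

theorem bitOutput_pair {m : ℕ} (hm : 0 < m) (X : List Bool) (j : ℕ) (o : Option Bool) :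
    bitOutput m X (2 * j) [o == some true, o == some false] =
      if m ∣ j then o.elim [] (tokWord X) else [] := by
  simp only [bitOutput, clock_two_mul hm, clock_two_mul_add_one hm]
  split_ifs <;> rcases o with _ | _ | _ <;> simp [pushWord, tokWord]

theorem flatMap_range_single (n i₀ : ℕ) (c : List Bool) :
    ((List.range n).flatMap fun i => if i = i₀ then c else []) = if i₀ < n then c else [] := by
  induction n with
  | zero => simp
  | succ n ih =>
    rw [List.range_succ, List.flatMap_append, ih]
    simp only [List.flatMap_cons, List.flatMap_nil, List.append_nil]
    split_ifs <;> first | (exfalso; omega) | simp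

theorem bitOutput_flatMap_range (m : ℕ) (X : List Bool) (t k : ℕ) (f : ℕ → List Bool)
    (hf : ∀ i, (f i).length = k) (n : ℕ) :
    bitOutput m X t ((List.range n).flatMap f) =
      (List.range n).flatMap fun i => bitOutput m X (t + k * i) (f i) := by
  induction n with
  | zero => simp [bitOutput]
  | succ n ih =>
    have : ((List.range n).flatMap f).length = k * n := by
      rw [List.length_flatMap]; simp [hf, mul_comm]
    rw [List.range_succ, List.flatMap_append, bitOutput_append, ih, this, List.flatMap_append]
    simp

/-- One row of the word of the token `true`, dealing with the tokens at index `l`. -/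
def tokRow (m : ℕ) (e : ℕ → List Bool) (l : ℕ) : List Bool :=
  (List.range m).flatMap fun i => [(e (m - i))[l]? == some true, (e (m - i))[l]? == some false]

/-- The word of the token `true`. -/
def tokTrue (m L : ℕ) (e : ℕ → List Bool) : List Bool := (List.range L).flatMap (tokRow m e)

theorem tokRow_length (m : ℕ) (e : ℕ → List Bool) (l : ℕ) : (tokRow m e l).length = 2 * m := by
  unfold tokRow
  rw [List.length_flatMap]
  simp [mul_comm]

theorem periodic_congr {m : ℕ} {e : ℕ → List Bool} (he : ∀ j, e (j + m) = e j) {j j' : ℕ}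
    (h : j ≡ j' [MOD m]) : e j = e j' := by
  have : Function.Periodic e m := he
  rw [← this.map_mod_nat j, ← this.map_mod_nat j', h]

theorem bitOutput_tokRow {m : ℕ} (hm : 0 < m) {e : ℕ → List Bool} (he : ∀ j, e (j + m) = e j)
    (X : List Bool) (φ l : ℕ) :
    bitOutput m X (2 * φ) (tokRow m e l) = ((e φ)[l]?).elim [] (tokWord X) := by
  unfold tokRow
  rw [bitOutput_flatMap_range m X _ 2 _ (fun i => rfl)]
  have hlt := Nat.mod_lt φ hm
  obtain ⟨i₀, hi₀, hd⟩ : ∃ i₀, i₀ < m ∧ m ∣ φ + i₀ := by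
    refine ⟨(m - φ % m) % m, Nat.mod_lt _ hm, ?_⟩
    rw [Nat.dvd_iff_mod_eq_zero, Nat.add_mod, Nat.mod_mod, ← Nat.add_mod]
    rw [← Nat.mod_add_mod, Nat.add_sub_cancel' hlt.le, Nat.mod_self]
  have huniq : ∀ i < m, m ∣ φ + i → i = i₀ := by
    intro i hi hdi
    have h1 : φ + i ≡ φ + i₀ [MOD m] :=
      ((Nat.modEq_zero_iff_dvd.2 hdi).trans (Nat.modEq_zero_iff_dvd.2 hd).symm)
    exact Nat.ModEq.eq_of_lt_of_lt (Nat.ModEq.add_left_cancel' φ h1) hi hi₀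
  have hφ : e (m - i₀) = e φ := by
    refine periodic_congr he (Nat.ModEq.add_right_cancel' i₀ ?_)
    rw [Nat.sub_add_cancel hi₀.le]
    exact (Nat.modEq_zero_iff_dvd.2 dvd_rfl).trans (Nat.modEq_zero_iff_dvd.2 hd).symm
  rw [List.flatMap_congr (g := fun i => if i = i₀ then ((e φ)[l]?).elim [] (tokWord X) else []),
    flatMap_range_single, if_pos hi₀]
  intro i hi
  rw [← mul_add, bitOutput_pair hm]
  have hi := List.mem_range.1 hi
  by_cases h : i = i₀
  · subst h
    rw [if_pos hd, if_pos rfl, hφ]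
  · rw [if_neg h, if_neg fun h' => h (huniq i hi h')]

theorem flatMap_range_getElem? (w : List Bool) (f : Bool → List Bool) (L : ℕ)
    (hL : w.length ≤ L) :
    ((List.range L).flatMap fun l => (w[l]?).elim [] f) = w.flatMap f := by
  induction w generalizing L with
  | nil => simp
  | cons b w ih =>
    obtain ⟨L, rfl⟩ : ∃ L', L = L' + 1 := ⟨L - 1, by simp at hL; omega⟩
    rw [List.range_succ_eq_map, List.flatMap_cons, List.flatMap_map, List.flatMap_cons]
    have := ih L (by simpa using hL)
    simp only [List.getElem?_cons_succ, List.getElem?_cons_zero, Option.elim_some, this]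

theorem bitOutput_tokTrue {m : ℕ} (hm : 0 < m) {e : ℕ → List Bool} (he : ∀ j, e (j + m) = e j)
    (X : List Bool) (φ L : ℕ) (hL : (e φ).length ≤ L) :
    bitOutput m X (2 * φ) (tokTrue m L e) = (e φ).flatMap (tokWord X) := by
  unfold tokTrue
  rw [bitOutput_flatMap_range m X _ (2 * m) _ (tokRow_length m e),
    ← flatMap_range_getElem? _ _ L hL]
  refine List.flatMap_congr fun l _ => ?_
  rw [← bitOutput_tokRow hm he]
  exact bitOutput_congr X (Nat.add_mul_mod_self_left _ _ _) _

theorem bitQueue_eq_nil_of_le {m : ℕ} {X q : List Bool} {t t' : ℕ} (h : t ≤ t')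
    (ht : bitQueue m X q t = []) : bitQueue m X q t' = [] := by
  induction t', h using Nat.le_induction with
  | base => exact ht
  | succ t' _ ih => rw [bitQueue, ih]

theorem exists_bitQueue_eq {m : ℕ} (hm : 0 < m) {e : ℕ → List Bool} (he : ∀ j, e (j + m) = e j)
    (L : ℕ) (hL : ∀ j, (e j).length ≤ L) (q : List Bool) (n : ℕ)
    (hn : ∀ k < n, ((tokStep e)^[k] (0, q)).2 ≠ []) :
    ∃ t ≥ n, t ≡ 2 * ((tokStep e)^[n] (0, q)).1 [MOD 2 * m] ∧
      bitQueue m (tokTrue m (L + 1) e) (q.flatMap (tokWord (tokTrue m (L + 1) e))) t =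
        ((tokStep e)^[n] (0, q)).2.flatMap (tokWord (tokTrue m (L + 1) e)) := by
  set X := tokTrue m (L + 1) e with hX
  have hXlen : X.length = 2 * m * (L + 1) := by
    rw [hX, tokTrue, List.length_flatMap]
    simp [tokRow_length, mul_comm]
  induction n with
  | zero => exact ⟨0, le_rfl, rfl, rfl⟩
  | succ n ih =>
    obtain ⟨t, htn, htm, ht⟩ := ih fun k hk => hn k (by omega)
    have hne := hn n (by omega)
    rw [Function.iterate_succ_apply']
    generalize (tokStep e)^[n] (0, q) = c at *
    obtain ⟨φ, Q⟩ := c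
    rcases Q with _ | ⟨_ | _, Q⟩
    · exact absurd rfl hne
    · refine ⟨t + 2, by omega, ?_, ?_⟩
      · exact htm.add_right 2
      · rw [List.flatMap_cons] at ht
        have h2 := bitQueue_add_length _ _ _ _ _ _ ht
        simp only [tokWord, Bool.false_eq_true, if_false, List.length_cons, List.length_nil,
          zero_add, Nat.reduceAdd] at h2
        rw [h2, bitOutput_congr X htm]
        have h3 : bitOutput m X (2 * φ) [false, false] = [] :=
          (bitOutput_pair hm X φ none).trans (by simp)
        exact (congrArg _ h3).trans (List.append_nil _)
    · refine ⟨t + X.length, ?_, ?_, ?_⟩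
      · have : 0 < X.length := by rw [hXlen]; positivity
        omega
      · rw [hXlen]
        exact (Nat.add_mul_mod_self_left _ _ _).trans htm
      · rw [List.flatMap_cons] at ht
        have h2 := bitQueue_add_length _ _ _ _ _ _ ht
        simp only [tokWord, if_true] at h2
        rw [h2, bitOutput_congr X htm]
        simp only [tokStep, List.flatMap_append]
        conv_lhs => rw [hX]
        rw [bitOutput_tokTrue hm he _ _ _ ((hL φ).trans (Nat.le_succ L))]

theorem exists_bitQueue_of_token {m : ℕ} (hm : 0 < m) {e : ℕ → List Bool}
    (he : ∀ j, e (j + m) = e j) :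
    ∃ X : List Bool, X ≠ [] ∧ ∀ N, (∃ t, bitQueue m X (List.replicate N X).flatten t = []) ↔
      ∃ n, ((tokStep e)^[n] (0, List.replicate N true)).2 = [] := by
  obtain ⟨L, hL⟩ : ∃ L, ∀ j, (e j).length ≤ L := by
    refine ⟨∑ j ∈ Finset.range m, (e j).length, fun j => ?_⟩
    rw [periodic_congr he (Nat.mod_modEq j m).symm]
    exact Finset.single_le_sum (f := fun j => (e j).length) (fun _ _ => Nat.zero_le _)
      (Finset.mem_range.2 (Nat.mod_lt j hm))
  have hX : tokTrue m (L + 1) e ≠ [] := by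
    rw [← List.length_pos_iff, tokTrue, List.length_flatMap]
    simp [tokRow_length, hm]
  refine ⟨tokTrue m (L + 1) e, hX, fun N => ?_⟩
  have hq : (List.replicate N true).flatMap (tokWord (tokTrue m (L + 1) e)) =
      (List.replicate N (tokTrue m (L + 1) e)).flatten := by
    rw [List.flatMap_def, List.map_replicate]
    rfl
  rw [← hq]
  have hnil : ∀ q : List Bool, q.flatMap (tokWord (tokTrue m (L + 1) e)) = [] → q = [] := by
    intro q h
    rcases q with _ | ⟨_ | _, q⟩
    · rfl
    · simp [tokWord] at h
    · simp [tokWord, hX] at h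
  constructor
  · rintro ⟨t, ht⟩
    by_contra hc
    push Not at hc
    obtain ⟨t', ht', -, h⟩ := exists_bitQueue_eq hm he L hL _ t fun k _ => hc k
    rw [bitQueue_eq_nil_of_le ht' ht] at h
    exact hc t (hnil _ h.symm)
  · intro h
    classical
    obtain ⟨t, -, -, ht⟩ := exists_bitQueue_eq hm he L hL (List.replicate N true) (Nat.find h)
      fun k hk => Nat.find_min h hk
    rw [Nat.find_spec h] at ht
    exact ⟨t, by simpa using ht⟩

end TokenQueue
end TauUndec

namespace TauUndec
section ResidueMachine

/-- `c'` is obtained from `c` by iterating `f`. -/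
def IterReaches {α : Type*} (f : α → α) (c c' : α) : Prop := ∃ n, f^[n] c = c'

theorem IterReaches.trans {α : Type*} {f : α → α} {a b c : α} (h : IterReaches f a b)
    (h' : IterReaches f b c) : IterReaches f a c := by
  obtain ⟨n, rfl⟩ := h
  obtain ⟨k, rfl⟩ := h'
  exact ⟨k + n, Function.iterate_add_apply _ _ _ _⟩

theorem iterate_tokStep_false (e : ℕ → List Bool) (φ k : ℕ) (q : List Bool) :
    (tokStep e)^[k] (φ, List.replicate k false ++ q) = (φ + k, q) := by
  induction k generalizing φ with
  | zero => rfl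
  | succ k ih =>
    rw [Function.iterate_succ_apply, List.replicate_succ, List.cons_append, tokStep, ih]
    congr 1
    ring

theorem iterate_tokStep_true (e : ℕ → List Bool) (φ k : ℕ) (q : List Bool) :
    (tokStep e)^[k] (φ, List.replicate k true ++ q) =
      (φ, q ++ (List.replicate k (e φ)).flatten) := by
  induction k generalizing q with
  | zero => simp
  | succ k ih =>
    rw [Function.iterate_succ_apply, List.replicate_succ, List.cons_append, tokStep,
      List.append_assoc, ih]
    simp [List.replicate_succ]

/-- Tokens `true` surrounded by tokens `false`. -/
def tokBlock (k₁ a k₂ : ℕ) : List Bool :=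
  List.replicate k₁ false ++ (List.replicate a true ++ List.replicate k₂ false)

theorem iterReaches_tokBlock (e : ℕ → List Bool) (φ k₁ a k₂ c : ℕ) (q : List Bool)
    (hc : e (φ + k₁) = List.replicate c true) :
    IterReaches (tokStep e) (φ, tokBlock k₁ a k₂ ++ q)
      (φ + (k₁ + k₂), q ++ List.replicate (a * c) true) := by
  refine IterReaches.trans (b := (φ + k₁, List.replicate a true ++
    (List.replicate k₂ false ++ q))) ⟨k₁, ?_⟩ (IterReaches.trans (b := (φ + k₁,
      List.replicate k₂ false ++ (q ++ List.replicate (a * c) true))) ⟨a, ?_⟩ ⟨k₂, ?_⟩)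
  · simp only [tokBlock, List.append_assoc]
    exact iterate_tokStep_false e φ k₁ _
  · rw [iterate_tokStep_true, hc]
    have : (List.replicate a (List.replicate c true)).flatten = List.replicate (a * c) true := by
      simp
    rw [this, List.append_assoc]
  · rw [iterate_tokStep_false, add_assoc]

theorem iterReaches_tokBlocks (e : ℕ → List Bool) (k₁ a k₂ : ℕ) (c : ℕ → ℕ) (G φ : ℕ)
    (q : List Bool)
    (hc : ∀ i < G, e (φ + i * (k₁ + k₂) + k₁) = List.replicate (c i) true) :
    IterReaches (tokStep e) (φ, (List.replicate G (tokBlock k₁ a k₂)).flatten ++ q)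
      (φ + G * (k₁ + k₂), q ++ List.replicate (a * ∑ i ∈ Finset.range G, c i) true) := by
  induction G generalizing φ q c with
  | zero => exact ⟨0, by simp⟩
  | succ G ih =>
    have h0 := hc 0 (Nat.succ_pos G)
    rw [zero_mul, add_zero] at h0
    rw [List.replicate_succ, List.flatten_cons, List.append_assoc]
    refine (iterReaches_tokBlock e φ k₁ a k₂ (c 0) _ h0).trans ?_
    rw [List.append_assoc]
    have := ih (fun i => c (i + 1)) (φ + (k₁ + k₂)) (q ++ List.replicate (a * c 0) true) ?_
    · rw [List.append_assoc, List.replicate_append_replicate, ← mul_add, add_comm (c 0),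
        ← Finset.sum_range_succ'] at this
      convert this using 2
      ring
    · intro i hi
      rw [← hc (i + 1) (by omega)]
      congr 1
      ring

theorem iterReaches_round (e : ℕ → List Bool) (k₁ a k₂ : ℕ) (c : ℕ → ℕ) (G φ : ℕ) (hG : 0 < G)
    (he : e φ = tokBlock k₁ a k₂)
    (hc : ∀ i < G, e (φ + i * (k₁ + k₂) + k₁) = List.replicate (c i) true) :
    ∃ n ≥ 1, (tokStep e)^[n] (φ, List.replicate G true) =
      (φ + G * (k₁ + k₂), List.replicate (a * ∑ i ∈ Finset.range G, c i) true) := by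
  obtain ⟨n, hn⟩ := iterReaches_tokBlocks e k₁ a k₂ c G φ [] hc
  refine ⟨n + G, by omega, ?_⟩
  rw [Function.iterate_add_apply]
  have := iterate_tokStep_true e φ G []
  rw [List.append_nil, List.nil_append, he] at this
  rw [this]
  simpa using hn

theorem iterate_tokStep_nil (e : ℕ → List Bool) (φ n : ℕ) :
    (tokStep e)^[n] (φ, []) = (φ, []) :=
  Function.iterate_fixed rfl n

theorem iterate_tokStep_eq_nil_of_le {e : ℕ → List Bool} {c : ℕ × List Bool} {n n' : ℕ}
    (h : n ≤ n') (hn : ((tokStep e)^[n] c).2 = []) : ((tokStep e)^[n'] c).2 = [] := by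
  obtain ⟨k, rfl⟩ := Nat.exists_eq_add_of_le' h
  rw [Function.iterate_add_apply]
  obtain ⟨φ, hφ⟩ : ∃ φ, (tokStep e)^[n] c = (φ, []) := ⟨_, Prod.ext rfl hn⟩
  rw [hφ, iterate_tokStep_nil]

theorem sum_range_dvd_sub (G d : ℕ) :
    ∑ i ∈ Finset.range G, (if d ∣ G - i then 1 else 0) = G / d := by
  rw [← Nat.card_multiples, Finset.card_filter,
    ← Finset.sum_range_reflect (fun j => if d ∣ j + 1 then 1 else 0)]
  refine Finset.sum_congr rfl fun i hi => ?_
  have := Finset.mem_range.1 hi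
  rw [show G - 1 - i + 1 = G - i by omega]

/-- A machine acting on pairs (state, positive number). In state `s` and when the number has
residue `u` modulo `P`, the value `act s u = some (s', a, f)` means that the machine enters the
state `s'` and replaces the number `G` by `a * (G / d f)`. -/
structure ResidueMachine where
  /-- The modulus determining the action. -/
  P : ℕ
  /-- A modulus bounding the number of states. -/
  M : ℕ
  /-- A modulus bounding the number of divisors. -/
  R : ℕ
  /-- The number of states. -/
  S : ℕ
  /-- The divisors. -/
  d : ℕ → ℕ
  /-- The transition function. -/
  act : ℕ → ℕ → Option (ℕ × ℕ × ℕ)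
  P_pos : 0 < P
  one_lt_R : 1 < R
  S_le : 2 * S ≤ M
  M_pos : 0 < M
  coprime_PM : P.Coprime M
  coprime_PR : P.Coprime R
  coprime_MR : M.Coprime R
  d_zero : d 0 = 1
  act_spec : ∀ s u s' a f, act s u = some (s', a, f) → f + 1 < R ∧ d f ∣ P

namespace ResidueMachine

variable (T : ResidueMachine)

/-- One step of the machine. -/
def step (c : ℕ × ℕ) : Option (ℕ × ℕ) :=
  (T.act c.1 (c.2 % T.P)).map fun x => (x.1, x.2.1 * (c.2 / T.d x.2.2))

theorem exists_code (x y z : ℕ) :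
    ∃ k, k ≡ x [MOD T.P] ∧ k ≡ y [MOD T.M] ∧ k ≡ z [MOD T.R] := by
  obtain ⟨k, h1, h2⟩ := Nat.chineseRemainder T.coprime_PM x y
  obtain ⟨l, h3, h4⟩ := Nat.chineseRemainder
    (Nat.Coprime.mul_left T.coprime_PR T.coprime_MR) k z
  exact ⟨l, (h3.of_mul_right _).trans h1, (h3.of_mul_left _).trans h2, h4⟩

/-- A number with prescribed residues. -/
noncomputable def code (x y z : ℕ) : ℕ := (T.exists_code x y z).choose

theorem code_P (x y z : ℕ) : T.code x y z ≡ x [MOD T.P] := (T.exists_code x y z).choose_spec.1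

theorem code_M (x y z : ℕ) : T.code x y z ≡ y [MOD T.M] := (T.exists_code x y z).choose_spec.2.1

theorem code_R (x y z : ℕ) : T.code x y z ≡ z [MOD T.R] := (T.exists_code x y z).choose_spec.2.2

/-- The words of the token machine simulating the residue machine. -/
noncomputable def words (φ : ℕ) : List Bool :=
  if φ % T.R = 0 then
    if φ % T.M % 2 = 0 then tokBlock (T.code 0 0 1) 1 (T.code 1 1 (T.R - 1))
    else match T.act (φ % T.M / 2) (φ % T.P) with
      | none => []
      | some (s', a, f) => tokBlock (T.code 0 0 (f + 1)) a
          (T.code (T.P - 1) (2 * s' + (T.M - φ % T.M)) (T.R - (f + 1)))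
  else if T.d (φ % T.R - 1) ∣ φ % T.P then [true] else []

theorem words_periodic (φ : ℕ) : T.words (φ + T.P * T.M * T.R) = T.words φ := by
  have h1 : (φ + T.P * T.M * T.R) % T.P = φ % T.P := by
    rw [mul_assoc, Nat.add_mul_mod_self_left]
  have h2 : (φ + T.P * T.M * T.R) % T.M = φ % T.M := by
    rw [mul_comm T.P, mul_assoc, Nat.add_mul_mod_self_left]
  have h3 : (φ + T.P * T.M * T.R) % T.R = φ % T.R := Nat.add_mul_mod_self_right _ _ _
  simp only [words, h1, h2, h3]

theorem code_add_code_R (f x y : ℕ) (hf : f + 1 < T.R) :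
    T.code 0 0 (f + 1) + T.code x y (T.R - (f + 1)) ≡ 0 [MOD T.R] := by
  refine ((T.code_R _ _ _).add (T.code_R _ _ _)).trans ?_
  rw [Nat.add_sub_cancel' hf.le]
  exact Nat.modEq_zero_iff_dvd.2 dvd_rfl

theorem code_add_code_P (z x y z' : ℕ) :
    T.code 0 0 z + T.code x y z' ≡ x [MOD T.P] := by
  simpa using (T.code_P 0 0 z).add (T.code_P x y z')

theorem code_add_code_M (z x y z' : ℕ) :
    T.code 0 0 z + T.code x y z' ≡ y [MOD T.M] := by
  simpa using (T.code_M 0 0 z).add (T.code_M x y z')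

theorem exists_round (φ G f a x y : ℕ) (hG : 0 < G) (hR : φ ≡ 0 [MOD T.R]) (hf : f + 1 < T.R)
    (hd : T.d f ∣ T.P)
    (he : T.words φ = tokBlock (T.code 0 0 (f + 1)) a (T.code x y (T.R - (f + 1)))) :
    ∃ n ≥ 1, ∃ φ', (tokStep T.words)^[n] (φ, List.replicate G true) =
      (φ', List.replicate (a * ∑ i ∈ Finset.range G, if T.d f ∣ φ + i * x then 1 else 0) true) ∧
      φ' ≡ φ + G * x [MOD T.P] ∧ φ' ≡ φ + G * y [MOD T.M] ∧ φ' ≡ 0 [MOD T.R] := by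
  have hP := T.code_add_code_P (f + 1) x y (T.R - (f + 1))
  have hM := T.code_add_code_M (f + 1) x y (T.R - (f + 1))
  have hR' := T.code_add_code_R f x y hf
  obtain ⟨n, hn1, hn⟩ := iterReaches_round T.words _ a _
    (fun i => if T.d f ∣ φ + i * x then 1 else 0) G φ hG he (fun i _ => by
      generalize hψ : φ + i * (T.code 0 0 (f + 1) + T.code x y (T.R - (f + 1))) +
        T.code 0 0 (f + 1) = ψ
      have h1 : ψ ≡ f + 1 [MOD T.R] := by
        rw [← hψ]
        simpa using (hR.add ((hR'.mul_left i))).add (T.code_R 0 0 (f + 1))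
      have h2 : ψ ≡ φ + i * x [MOD T.P] := by
        rw [← hψ]
        simpa using (Nat.ModEq.rfl.add ((hP.mul_left i))).add (T.code_P 0 0 (f + 1))
      have h3 : ψ % T.R = f + 1 := Nat.mod_eq_of_modEq h1 hf
      have h4 : T.d f ∣ ψ % T.P ↔ T.d f ∣ φ + i * x := by
        rw [Nat.dvd_mod_iff hd]
        exact (h2.of_dvd hd).dvd_iff dvd_rfl
      simp only [words, h3, Nat.add_sub_cancel, h4, Nat.succ_ne_zero, if_false]
      split_ifs <;> rfl)
  refine ⟨n, hn1, _, hn, ?_, ?_, ?_⟩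
  · exact Nat.ModEq.rfl.add (hP.mul_left G)
  · exact Nat.ModEq.rfl.add (hM.mul_left G)
  · simpa using hR.add (hR'.mul_left G)

/-- The configurations of the token machine that represent a given configuration. -/
def Represents (c : ℕ × ℕ) (x : ℕ × List Bool) : Prop :=
  x.1 ≡ 0 [MOD T.P] ∧ x.1 ≡ 2 * c.1 [MOD T.M] ∧ x.1 ≡ 0 [MOD T.R] ∧
    x.2 = List.replicate c.2 true

theorem exists_iterate_test {c : ℕ × ℕ} {x : ℕ × List Bool} (hx : T.Represents c x)
    (hs : c.1 < T.S) (hG : 0 < c.2) (hGM : c.2 ≡ 1 [MOD T.M]) :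
    ∃ n ≥ 1, ∃ φ, (tokStep T.words)^[n] x = (φ, List.replicate c.2 true) ∧
      φ ≡ c.2 [MOD T.P] ∧ φ % T.M = 2 * c.1 + 1 ∧ φ ≡ 0 [MOD T.R] := by
  obtain ⟨s, G⟩ := c
  obtain ⟨φ, q⟩ := x
  obtain ⟨h1, h2, h3, rfl⟩ := hx
  simp only at *
  have hS := T.S_le
  have h2' : φ % T.M = 2 * s := Nat.mod_eq_of_modEq h2 (by omega)
  have he : T.words φ = tokBlock (T.code 0 0 (0 + 1)) 1 (T.code 1 1 (T.R - (0 + 1))) := by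
    have h3' : φ % T.R = 0 := Nat.mod_eq_of_modEq h3 (by have := T.one_lt_R; omega)
    simp [words, h3', h2']
  obtain ⟨n, hn1, φ', hn, hP, hM, hR⟩ := T.exists_round φ G 0 1 1 1 hG h3 T.one_lt_R
    (by rw [T.d_zero]; exact one_dvd _) he
  refine ⟨n, hn1, φ', ?_, ?_, ?_, hR⟩
  · rw [hn]
    simp [T.d_zero]
  · simpa using hP.trans (h1.add_right _)
  · refine Nat.mod_eq_of_modEq (hM.trans ?_) (by omega)
    rw [mul_one]
    exact h2.add hGM

theorem exists_iterate_of_step {c c' : ℕ × ℕ} {x : ℕ × List Bool} (hx : T.Represents c x)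
    (hs : c.1 < T.S) (hG : 0 < c.2) (hGM : c.2 ≡ 1 [MOD T.M]) (hc : T.step c = some c') :
    ∃ n ≥ 1, T.Represents c' ((tokStep T.words)^[n] x) := by
  obtain ⟨n, hn1, φ, hn, hP, hM, hR⟩ := T.exists_iterate_test hx hs hG hGM
  obtain ⟨s, G⟩ := c
  simp only [step, Option.map_eq_some_iff, Prod.exists] at hc
  obtain ⟨s', a, f, hact, rfl⟩ := hc
  simp only at *
  obtain ⟨hf, hd⟩ := T.act_spec _ _ _ _ _ hact
  have he : T.words φ = tokBlock (T.code 0 0 (f + 1)) a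
      (T.code (T.P - 1) (2 * s' + (T.M - (2 * s + 1))) (T.R - (f + 1))) := by
    have h3' : φ % T.R = 0 := Nat.mod_eq_of_modEq hR (by have := T.one_lt_R; omega)
    have h4 : (2 * s + 1) % 2 = 1 := by omega
    have h5 : (2 * s + 1) / 2 = s := by omega
    have h6 : φ % T.P = G % T.P := hP
    simp only [words, h3', hM, h4, h5, h6, hact, if_true, one_ne_zero, if_false]
  obtain ⟨k, hk1, φ', hk, hP', hM', hR'⟩ := T.exists_round φ G f a _ _ hG hR hf hd he
  refine ⟨k + n, by omega, ?_⟩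
  rw [Function.iterate_add_apply, hn, hk]
  have hPpos := T.P_pos
  refine ⟨?_, ?_, hR', ?_⟩
  · refine hP'.trans ((hP.add_right _).trans ?_)
    have : G + G * (T.P - 1) = G * T.P := by
      obtain ⟨p, hp⟩ := Nat.exists_eq_succ_of_ne_zero hPpos.ne'
      rw [hp]; simp only [Nat.succ_eq_add_one, Nat.add_sub_cancel]; ring
    rw [this]
    exact Nat.modEq_zero_iff_dvd.2 (dvd_mul_left _ _)
  · refine hM'.trans ?_
    have hS := T.S_le
    have h1 : φ ≡ 2 * s + 1 [MOD T.M] := by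
      rw [← hM]; exact (Nat.mod_modEq _ _).symm
    refine (h1.add (hGM.mul_right _)).trans ?_
    have : 2 * s + 1 + 1 * (2 * s' + (T.M - (2 * s + 1))) = 2 * s' + T.M := by omega
    rw [this]
    exact Nat.add_mod_right _ _
  · simp only
    congr 2
    rw [← sum_range_dvd_sub]
    refine Finset.sum_congr rfl fun i hi => ?_
    have hi := Finset.mem_range.1 hi
    have : φ + i * (T.P - 1) ≡ G - i [MOD T.P] := by
      refine Nat.ModEq.add_right_cancel' i ?_
      rw [Nat.sub_add_cancel hi.le]
      have h1 : φ + i * (T.P - 1) + i = φ + i * T.P := by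
        obtain ⟨p, hp⟩ := Nat.exists_eq_succ_of_ne_zero hPpos.ne'
        rw [hp]; simp only [Nat.succ_eq_add_one, Nat.add_sub_cancel]; ring
      rw [h1]
      exact (Nat.add_mul_mod_self_right _ _ _).trans hP
    simp only [(this.of_dvd hd).dvd_iff dvd_rfl]

theorem exists_iterate_of_halt {c : ℕ × ℕ} {x : ℕ × List Bool} (hx : T.Represents c x)
    (hs : c.1 < T.S) (hG : 0 < c.2) (hGM : c.2 ≡ 1 [MOD T.M]) (hc : T.step c = none) :
    ∃ n, ((tokStep T.words)^[n] x).2 = [] := by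
  obtain ⟨n, hn1, φ, hn, hP, hM, hR⟩ := T.exists_iterate_test hx hs hG hGM
  obtain ⟨s, G⟩ := c
  simp only [step, Option.map_eq_none_iff] at hc
  simp only at *
  have he : T.words φ = [] := by
    have h3' : φ % T.R = 0 := Nat.mod_eq_of_modEq hR (by have := T.one_lt_R; omega)
    have h4 : (2 * s + 1) % 2 = 1 := by omega
    have h5 : (2 * s + 1) / 2 = s := by omega
    have h6 : φ % T.P = G % T.P := hP
    simp only [words, h3', hM, h4, h5, h6, hc, if_true, one_ne_zero, if_false]
  refine ⟨G + n, ?_⟩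
  rw [Function.iterate_add_apply, hn]
  have := iterate_tokStep_true T.words φ G []
  rw [List.append_nil] at this
  rw [this, he]
  simp

theorem exists_nil_iff_halts (Inv : ℕ × ℕ → Prop)
    (hInv : ∀ c, Inv c → c.1 < T.S ∧ 0 < c.2 ∧ c.2 ≡ 1 [MOD T.M])
    (hstep : ∀ c c', Inv c → T.step c = some c' → Inv c') (G : ℕ) (hG : Inv (0, G)) :
    (∃ n, ((tokStep T.words)^[n] (0, List.replicate G true)).2 = []) ↔
      ∃ c, Relation.ReflTransGen (fun a b => T.step a = some b) (0, G) c ∧ T.step c = none := by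
  have h0 : T.Represents (0, G) (0, List.replicate G true) := ⟨rfl, rfl, rfl, rfl⟩
  constructor
  · rintro ⟨n, hn⟩
    by_contra hc
    push Not at hc
    have key : ∀ k, ∃ l ≥ k, ∃ c,
        Relation.ReflTransGen (fun a b => T.step a = some b) (0, G) c ∧ Inv c ∧
        T.Represents c ((tokStep T.words)^[l] (0, List.replicate G true)) := by
      intro k
      induction k with
      | zero => exact ⟨0, le_rfl, _, Relation.ReflTransGen.refl, hG, h0⟩
      | succ k ih =>
        obtain ⟨l, hl, c, hr, hi, hrep⟩ := ih
        obtain ⟨c', hc'⟩ := Option.ne_none_iff_exists'.1 (hc c hr)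
        obtain ⟨h1, h2, h3⟩ := hInv c hi
        obtain ⟨j, hj, hrep'⟩ := T.exists_iterate_of_step hrep h1 h2 h3 hc'
        refine ⟨j + l, by omega, c', hr.tail hc', hstep _ _ hi hc', ?_⟩
        rwa [Function.iterate_add_apply]
    obtain ⟨l, hl, c, -, hi, hrep⟩ := key n
    have h1 := iterate_tokStep_eq_nil_of_le hl hn
    rw [hrep.2.2.2] at h1
    have h2 := (hInv c hi).2.1
    rw [List.replicate_eq_nil_iff] at h1
    omega
  · rintro ⟨c, hr, hc⟩
    have key : Inv c ∧ ∃ l, T.Represents c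
        ((tokStep T.words)^[l] (0, List.replicate G true)) := by
      clear hc
      induction hr with
      | refl => exact ⟨hG, 0, h0⟩
      | tail _ hab ih =>
        obtain ⟨hi, l, hrep⟩ := ih
        obtain ⟨h1, h2, h3⟩ := hInv _ hi
        obtain ⟨j, -, hrep'⟩ := T.exists_iterate_of_step hrep h1 h2 h3 hab
        refine ⟨hstep _ _ hi hab, j + l, ?_⟩
        rwa [Function.iterate_add_apply]
    obtain ⟨hi, l, hrep⟩ := key
    obtain ⟨h1, h2, h3⟩ := hInv _ hi
    obtain ⟨j, hj⟩ := T.exists_iterate_of_halt hrep h1 h2 h3 hc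
    refine ⟨j + l, ?_⟩
    rwa [Function.iterate_add_apply]

end ResidueMachine
end ResidueMachine
end TauUndec

namespace TauUndec

/-- While programs on a store of natural-number registers. -/
inductive RegProg : Type
  | inc (i : ℕ)
  | dec (i : ℕ)
  | seq (p q : RegProg)
  | loop (i : ℕ) (p : RegProg)

namespace RegProg

open Function Relation

/-- One step of a configuration: a stack of programs still to be run, and a store. -/
def step : List RegProg × (ℕ → ℕ) → Option (List RegProg × (ℕ → ℕ))
  | ([], _) => none
  | (inc i :: k, σ) => some (k, update σ i (σ i + 1))
  | (dec i :: k, σ) => some (k, update σ i (σ i - 1))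
  | (seq p q :: k, σ) => some (p :: q :: k, σ)
  | (loop i p :: k, σ) => some (if σ i = 0 then k else p :: loop i p :: k, σ)

/-- Running `p` on the store `σ` ends with the store `τ`. -/
def Runs (p : RegProg) (σ τ : ℕ → ℕ) : Prop :=
  ∀ k, ReflTransGen (fun a b => step a = some b) (p :: k, σ) (k, τ)

theorem runs_inc (i : ℕ) (σ : ℕ → ℕ) : Runs (inc i) σ (update σ i (σ i + 1)) :=
  fun _ => .single rfl

theorem runs_dec (i : ℕ) (σ : ℕ → ℕ) : Runs (dec i) σ (update σ i (σ i - 1)) :=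
  fun _ => .single rfl

theorem Runs.seq {p q : RegProg} {σ τ υ : ℕ → ℕ} (hp : Runs p σ τ) (hq : Runs q τ υ) :
    Runs (p.seq q) σ υ :=
  fun k => .head (b := (p :: q :: k, σ)) rfl ((hp (q :: k)).trans (hq k))

theorem runs_loop {i : ℕ} {p : RegProg} (F : ℕ → ℕ → ℕ) (N : ℕ)
    (hF : ∀ j < N, F j i ≠ 0 ∧ Runs p (F j) (F (j + 1))) (hN : F N i = 0) :
    Runs (loop i p) (F 0) (F N) := by
  intro k
  have hend : ReflTransGen (fun a b => step a = some b) (loop i p :: k, F N) (k, F N) :=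
    .single (by simp [step, hN])
  have hmid : ∀ n ≤ N, ReflTransGen (fun a b => step a = some b)
      (loop i p :: k, F 0) (loop i p :: k, F n) := by
    intro n hn
    induction n with
    | zero => exact .refl
    | succ n ih =>
      obtain ⟨h0, hr⟩ := hF n (by omega)
      refine (ih (by omega)).trans (.head (b := (p :: loop i p :: k, F n)) ?_ (hr _))
      simp [step, h0]
  exact (hmid N le_rfl).trans hend

/-- Empties the register `x`. -/
def clear (x : ℕ) : RegProg := loop x (dec x)

theorem runs_clear (x : ℕ) (σ : ℕ → ℕ) : Runs (clear x) σ (update σ x 0) := by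
  have h := runs_loop (i := x) (p := dec x) (fun j => update σ x (σ x - j)) (σ x)
    (fun j hj => ⟨by simp; omega, ?_⟩) (by simp)
  · simpa [clear] using h
  · convert runs_dec x _ using 1
    funext r
    by_cases hr : r = x <;> simp [hr]
    omega

/-- Adds the register `x` to the register `y`, emptying `x`. -/
def move (x y : ℕ) : RegProg := loop x (seq (dec x) (inc y))

theorem runs_move {x y : ℕ} (hxy : x ≠ y) (σ : ℕ → ℕ) :
    Runs (move x y) σ (update (update σ x 0) y (σ y + σ x)) := by
  have h := runs_loop (i := x) (p := seq (dec x) (inc y))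
    (fun j => update (update σ x (σ x - j)) y (σ y + j)) (σ x)
    (fun j hj => ⟨by simp [hxy]; omega, ?_⟩) (by simp [hxy])
  · simpa [move] using h
  · convert (runs_dec x _).seq (runs_inc y _) using 1
    funext r
    grind [update_apply]

/-- Adds the register `x` to the register `y`, using `t` as scratch. -/
def copy (x y t : ℕ) : RegProg :=
  seq (loop x (seq (dec x) (seq (inc y) (inc t)))) (move t x)

theorem runs_copy {x y t : ℕ} (hxy : x ≠ y) (hxt : x ≠ t) (hyt : y ≠ t) {σ : ℕ → ℕ}
    (ht : σ t = 0) : Runs (copy x y t) σ (update σ y (σ y + σ x)) := by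
  have h := runs_loop (i := x) (p := seq (dec x) (seq (inc y) (inc t)))
    (fun j => update (update (update σ x (σ x - j)) y (σ y + j)) t j) (σ x)
    (fun j hj => ⟨by simp [hxy, hxt]; omega, ?_⟩) (by simp [hxy, hxt])
  · have h0 : update (update (update σ x (σ x - 0)) y (σ y + 0)) t 0 = σ := by
      funext r
      grind [update_apply]
    have h1 : Runs (loop x (seq (dec x) (seq (inc y) (inc t)))) σ
        (update (update (update σ x (σ x - σ x)) y (σ y + σ x)) t (σ x)) := by
      convert h using 1
      exact h0.symm
    rw [copy]
    convert h1.seq (runs_move (Ne.symm hxt) _) using 1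
    funext r
    grind [update_apply]
  · convert (runs_dec x _).seq ((runs_inc y _).seq (runs_inc t _)) using 1
    funext r
    grind [update_apply]

/-- `p` adds `f` of the registers `ins` to the empty register `out`, provided that all registers
from `b` on are empty, and changes nothing else. -/
def Computes {n : ℕ} (p : RegProg) (f : List.Vector ℕ n → ℕ) (ins : Fin n → ℕ) (out b : ℕ) :
    Prop :=
  ∀ σ : ℕ → ℕ, (∀ r, b ≤ r → σ r = 0) → σ out = 0 →
    Runs p σ (update σ out (f (List.Vector.ofFn fun i => σ (ins i))))

theorem exists_runs_fill {m n b : ℕ} {g : Fin n → List.Vector ℕ m → ℕ} {ins : Fin m → ℕ}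
    (hins : ∀ i, ins i < b) (p : Fin n → RegProg)
    (hp : ∀ i : Fin n, Computes (p i) (g i) ins (b + i) (b + n)) (j : ℕ) (hj : j ≤ n) :
    ∃ q : RegProg, ∀ σ : ℕ → ℕ, (∀ r, b ≤ r → σ r = 0) → Runs q σ fun r =>
      if h : b ≤ r ∧ r < b + j then
        g ⟨r - b, by omega⟩ (List.Vector.ofFn fun i => σ (ins i)) else σ r := by
  induction j with
  | zero =>
    refine ⟨dec b, fun σ hσ => ?_⟩
    convert runs_dec b σ using 1
    funext r
    grind [update_apply]
  | succ j ih =>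
    obtain ⟨q, hq⟩ := ih (by omega)
    refine ⟨q.seq (p ⟨j, hj⟩), fun σ hσ => ?_⟩
    convert (hq σ hσ).seq (hp ⟨j, hj⟩ _ ?_ ?_) using 1
    · funext r
      have hi : ∀ i, ¬ b ≤ ins i := fun i => by have := hins i; omega
      simp only [hi, false_and, dite_false, update_apply]
      by_cases h1 : r = b + j
      · subst h1
        simp
      · by_cases h2 : b ≤ r ∧ r < b + j
        · have h3 : b ≤ r ∧ r < b + (j + 1) := by omega
          simp [h1, h2, h3]
        · have h3 : ¬ (b ≤ r ∧ r < b + (j + 1)) := by omega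
          simp [h1, h2, h3]
    · intro r hr
      have h3 : ¬ (b ≤ r ∧ r < b + j) := by omega
      simp only [h3, dite_false]
      exact hσ r (by omega)
    · simp [hσ]

theorem exists_runs_clear (b n : ℕ) :
    ∃ q : RegProg, ∀ σ : ℕ → ℕ, Runs q σ fun r => if b ≤ r ∧ r < b + n then 0 else σ r := by
  induction n with
  | zero =>
    refine ⟨seq (inc b) (dec b), fun σ => ?_⟩
    convert (runs_inc b σ).seq (runs_dec b _) using 1
    funext r
    grind [update_apply]
  | succ n ih =>
    obtain ⟨q, hq⟩ := ih
    refine ⟨q.seq (clear (b + n)), fun σ => ?_⟩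
    convert (hq σ).seq (runs_clear (b + n) _) using 1
    funext r
    grind [update_apply]

theorem exists_computes {n : ℕ} {f : List.Vector ℕ n → ℕ} (hf : Nat.Primrec' f) :
    ∀ (ins : Fin n → ℕ) (out b : ℕ), (∀ i, ins i < b) → out < b → (∀ i, ins i ≠ out) →
      ∃ p, Computes p f ins out b := by
  induction hf with
  | zero =>
    intro ins out b _ hb _
    refine ⟨dec b, fun σ hσ ho => ?_⟩
    convert runs_dec b σ using 1
    funext r
    grind [update_apply]
  | succ =>
    intro ins out b hins hb hne
    refine ⟨seq (copy (ins 0) out b) (inc out), fun σ hσ ho => ?_⟩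
    have h0 := hins 0
    convert (runs_copy (hne 0) h0.ne hb.ne (hσ b le_rfl)).seq (runs_inc out _) using 1
    funext r
    have : (List.Vector.ofFn fun i => σ (ins i)).head = σ (ins 0) := by
      rw [← List.Vector.get_zero, List.Vector.get_ofFn]
    grind [update_apply]
  | get i =>
    intro ins out b hins hb hne
    refine ⟨copy (ins i) out b, fun σ hσ ho => ?_⟩
    convert runs_copy (hne i) (hins i).ne hb.ne (hσ b le_rfl) using 1
    simp [ho]
  | @comp m n f g _ _ ihf ihg =>
    intro ins out b hins hb hne
    choose p hp using fun i : Fin n => ihg i ins (b + i) (b + n)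
      (fun j => by have := hins j; omega) (by omega) (fun j => by have := hins j; omega)
    obtain ⟨q, hq⟩ := ihf (fun i => b + i) out (b + n) (fun i => by omega) (by omega)
      (fun i => by omega)
    obtain ⟨u, hu⟩ := exists_runs_fill hins p hp n le_rfl
    obtain ⟨c, hc⟩ := exists_runs_clear b n
    refine ⟨u.seq (q.seq c), fun σ hσ ho => ?_⟩
    convert (hu σ hσ).seq ((hq _ ?_ ?_).seq (hc _)) using 1
    · funext r
      have hbo : ¬ b ≤ out := by omega
      simp only [update_apply]
      by_cases h1 : r = out
      · subst h1
        simp [hbo]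
      · by_cases h2 : b ≤ r ∧ r < b + n
        · simp [h1, h2, hσ]
        · simp [h1, h2]
    · intro r hr
      have h3 : ¬ (b ≤ r ∧ r < b + n) := by omega
      simp only [h3, dite_false]
      exact hσ r (by omega)
    · have hbo : ¬ b ≤ out := by omega
      simp [hbo, ho]
  | @prec n f g _ _ ihf ihg =>
    intro ins out b hins hb hne
    obtain ⟨pf, hpf⟩ := ihf (fun i => ins i.succ) (b + 1) (b + 4)
      (fun i => by have := hins i.succ; omega) (by omega)
      (fun i => by have := hins i.succ; omega)
    obtain ⟨pg, hpg⟩ := ihg (Fin.cons b (Fin.cons (b + 1) fun i => ins i.succ)) (b + 3) (b + 4)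
      (fun i => by
        refine Fin.cases ?_ (fun i => ?_) i
        · simp
        · refine Fin.cases ?_ (fun i => ?_) i
          · simp
          · have := hins i.succ
            simp only [Fin.cons_succ]; omega) (by omega)
      (fun i => by
        refine Fin.cases ?_ (fun i => ?_) i
        · simp
        · refine Fin.cases ?_ (fun i => ?_) i
          · simp
          · have := hins i.succ
            simp only [Fin.cons_succ]; omega)
    refine ⟨seq (copy (ins 0) (b + 2) (b + 3)) <| seq pf <|
      seq (loop (b + 2) (seq (dec (b + 2)) <| seq pg <| seq (clear (b + 1)) <|
        seq (move (b + 3) (b + 1)) (inc b))) <|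
      seq (move (b + 1) out) (clear b), fun σ hσ ho => ?_⟩
    have hi0 := hins 0
    have hi := fun i : Fin n => hins i.succ
    have hn0 := hne 0
    have e0 : σ b = 0 := hσ _ (by omega)
    have e1 : σ (b + 1) = 0 := hσ _ (by omega)
    have e2 : σ (b + 2) = 0 := hσ _ (by omega)
    have e3 : σ (b + 3) = 0 := hσ _ (by omega)
    have e4 : ∀ r, b + 4 ≤ r → σ r = 0 := fun r hr => hσ r (by omega)
    set N := σ (ins 0) with hN
    set tl : List.Vector ℕ n := List.Vector.ofFn fun i => σ (ins i.succ) with htl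
    let rec' : ℕ → ℕ := fun j => Nat.rec (f tl) (fun y IH => g (y ::ᵥ IH ::ᵥ tl)) j
    let F : ℕ → ℕ → ℕ := fun j => update (update (update σ b j) (b + 1) (rec' j)) (b + 2) (N - j)
    have hF : ∀ j r, F j r = if r = b + 2 then N - j else if r = b + 1 then rec' j else
        if r = b then j else σ r := fun j r => by simp [F, update_apply]
    have hcopy := runs_copy (x := ins 0) (y := b + 2) (t := b + 3) (σ := σ) (by omega)
      (by omega) (by omega) e3
    have hinit : Runs pf (update σ (b + 2) (σ (b + 2) + σ (ins 0))) (F 0) := by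
      convert hpf _ ?_ ?_ using 1
      · funext r
        have : (fun i : Fin n => update σ (b + 2) (σ (b + 2) + σ (ins 0)) (ins i.succ)) =
            fun i => σ (ins i.succ) := by
          funext i
          have := hi i
          rw [update_of_ne (by omega)]
        rw [this, hF]
        have hr0 : rec' 0 = f tl := rfl
        rw [hr0, ← htl]
        simp only [update_apply]
        grind
      · intro r hr
        rw [update_of_ne (by omega), e4 r hr]
      · rw [update_of_ne (by omega), e1]
    have hloop := runs_loop (i := b + 2) (p := seq (dec (b + 2)) <| seq pg <|
      seq (clear (b + 1)) <| seq (move (b + 3) (b + 1)) (inc b)) F N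
      (fun j hj => ⟨by rw [hF]; simp; omega, by
        convert (runs_dec (b + 2) _).seq ((hpg _ ?_ ?_).seq ((runs_clear (b + 1) _).seq
          ((runs_move (x := b + 3) (y := b + 1) (by omega) _).seq (runs_inc b _)))) using 1
        · have hs : rec' (j + 1) = g (j ::ᵥ rec' j ::ᵥ tl) := rfl
          have hv : (List.Vector.ofFn fun i => update (F j) (b + 2) (F j (b + 2) - 1)
              ((Fin.cons b (Fin.cons (b + 1) fun i => ins i.succ) : Fin (n + 2) → ℕ) i)) =
              j ::ᵥ rec' j ::ᵥ tl := by
            rw [List.Vector.ofFn, List.Vector.ofFn]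
            simp only [Fin.cons_zero, Fin.cons_succ, update_apply, hF]
            congr 1
            · simp
            · congr 1
              · simp
              · rw [htl]
                congr 1
                funext i
                have := hi i
                grind
          rw [hv, ← hs]
          funext r
          simp only [update_apply, hF]
          grind
        · intro r hr
          rw [update_of_ne (by omega), hF]
          have := e4 r hr
          grind
        · rw [update_of_ne (by omega), hF]
          grind⟩) (by rw [hF]; simp)
    convert hcopy.seq (hinit.seq (hloop.seq ((runs_move (x := b + 1) (y := out)
      (by omega) _).seq (runs_clear b _)))) using 1
    have hv : (List.Vector.ofFn fun i => σ (ins i)) = N ::ᵥ tl := rfl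
    rw [hv]
    simp only [List.Vector.head_cons, List.Vector.tail_cons]
    change update σ out (rec' N) = _
    funext r
    simp only [update_apply, hF]
    grind

theorem acc_of_reaches_halt {c e : List RegProg × (ℕ → ℕ)}
    (h : ReflTransGen (fun a b => step a = some b) c e) (he : step e = none) :
    Acc (TransGen fun b a => step a = some b) c := by
  have : Acc (fun b a => step a = some b) c := by
    induction h using ReflTransGen.head_induction_on with
    | refl => exact ⟨_, fun y hy => by simp [he] at hy⟩
    | head h _ ih =>
      refine ⟨_, fun y hy => ?_⟩
      rw [h] at hy
      cases hy
      exact ih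
  exact this.transGen

/-- A program which, started with only the register `0` nonzero, searches for a zero of a
primitive recursive function. -/
theorem exists_halts_iff {g : ℕ → ℕ → ℕ} (hg : Primrec₂ g) :
    ∃ p : RegProg, ∀ n, (∃ e, ReflTransGen (fun a b => step a = some b)
        ([p], update (fun _ => 0) 0 n) e ∧ step e = none) ↔ ∃ j, g n j = 0 := by
  obtain ⟨q, hq⟩ := exists_computes (Nat.Primrec'.prim_iff₂.2 hg) ![0, 1] 2 3
    (by simp [Fin.forall_fin_two]) (by omega) (by simp [Fin.forall_fin_two])
  have hq' : ∀ n j, Runs q (update (update (fun _ => 0) 0 n) 1 j)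
      (update (update (update (fun _ => 0) 0 n) 1 j) 2 (g n j)) := by
    intro n j
    have h := hq (update (update (fun _ => 0) 0 n) 1 j) (fun r hr => by
      rw [update_of_ne (by omega), update_of_ne (by omega)]) (by simp)
    simpa [List.Vector.ofFn] using h
  let body := seq (clear 2) (seq q (inc 1))
  refine ⟨seq (inc 2) (loop 2 body), fun n => ?_⟩
  let t : ℕ → ℕ := fun j => Nat.casesOn j 1 (g n)
  let F : ℕ → ℕ → ℕ := fun j => update (update (update (fun _ => 0) 0 n) 1 j) 2 (t j)
  have hbody : ∀ j, Runs body (F j) (F (j + 1)) := by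
    intro j
    convert (runs_clear 2 (F j)).seq (Runs.seq (τ := update (update (update (fun _ => 0) 0 n) 1 j)
      2 (g n j)) ?_ (runs_inc 1 _)) using 1
    · have : t (j + 1) = g n j := rfl
      funext r
      simp only [F, this, update_apply]
      grind
    · convert hq' n j using 1
      funext r
      simp only [F, update_apply]
      grind
  have hstart : ReflTransGen (fun a b => step a = some b)
      ([seq (inc 2) (loop 2 body)], update (fun _ => 0) 0 n) ([loop 2 body], F 0) := by
    refine .head (b := ([inc 2, loop 2 body], update (fun _ => 0) 0 n)) rfl (.single ?_)
    have : update (update (fun _ => 0) 0 n) 2 (update (fun _ => 0) 0 n 2 + 1) = F 0 := by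
      have : t 0 = 1 := rfl
      funext r
      simp only [F, this, update_apply]
      grind
    rw [step, this]
  constructor
  · rintro ⟨e, he, hn⟩
    have key : ∀ c, Acc (TransGen fun b a => step a = some b) c → ∀ j, c = ([loop 2 body], F j) →
        ∃ i, g n i = 0 := by
      intro c hc
      induction hc with
      | intro c _ ih =>
        rintro j rfl
        rcases eq_or_ne (t j) 0 with h0 | h0
        · cases j with
          | zero => exact absurd h0 one_ne_zero
          | succ j => exact ⟨j, h0⟩
        · refine ih _ (transGen_swap.2 (.head' ?_ (hbody j [loop 2 body]))) (j + 1) rfl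
          simp [step, F, h0]
    have hacc := acc_of_reaches_halt he hn
    rcases reflTransGen_iff_eq_or_transGen.1 hstart with h | h
    · exact key _ hacc 0 h.symm
    · exact key _ (hacc.inv (transGen_swap.2 h)) 0 rfl
  · intro h
    classical
    have hN : t (Nat.find h + 1) = 0 := Nat.find_spec h
    have hlt : ∀ j < Nat.find h + 1, t j ≠ 0 := by
      rintro (_ | j) hj
      · exact one_ne_zero
      · exact Nat.find_min h (by omega)
    have hl := runs_loop (i := 2) F (Nat.find h + 1)
      (fun j hj => ⟨by simpa [F] using hlt j hj, hbody j⟩) (by simpa [F] using hN)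
    exact ⟨_, hstart.trans (hl []), rfl⟩

end RegProg
end TauUndec

namespace TauUndec

namespace RegProg

open Function Relation

/-- All stacks met while running `p` on top of the stack `k`, except `k` itself. -/
def conts : RegProg → List RegProg → List (List RegProg)
  | inc i, k => [inc i :: k]
  | dec i, k => [dec i :: k]
  | seq p q, k => (seq p q :: k) :: (conts p (q :: k) ++ conts q k)
  | loop i p, k => (loop i p :: k) :: conts p (loop i p :: k)

theorem head?_conts (p : RegProg) (k : List RegProg) : (conts p k).head? = some (p :: k) := by
  cases p <;> rfl

theorem cons_mem_conts (p : RegProg) (k : List RegProg) : p :: k ∈ conts p k :=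
  List.mem_of_mem_head? (head?_conts p k)

theorem step_mem_conts (p : RegProg) :
    ∀ (k c : List RegProg) (σ : ℕ → ℕ) (c' : List RegProg × (ℕ → ℕ)), c ∈ conts p k →
      step (c, σ) = some c' → c'.1 ∈ conts p k ∨ c'.1 = k := by
  induction p with
  | inc i =>
    intro k c σ c' hc h
    simp only [conts, List.mem_singleton] at hc
    subst hc
    simp only [step, Option.some.injEq] at h
    subst h
    exact Or.inr rfl
  | dec i =>
    intro k c σ c' hc h
    simp only [conts, List.mem_singleton] at hc
    subst hc
    simp only [step, Option.some.injEq] at h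
    subst h
    exact Or.inr rfl
  | seq p q ihp ihq =>
    intro k c σ c' hc h
    simp only [conts, List.mem_cons, List.mem_append] at hc ⊢
    rcases hc with rfl | hc | hc
    · simp only [step, Option.some.injEq] at h
      subst h
      exact Or.inl (Or.inr (Or.inl (cons_mem_conts _ _)))
    · rcases ihp _ _ _ _ hc h with h | h
      · exact Or.inl (Or.inr (Or.inl h))
      · exact Or.inl (Or.inr (Or.inr (h ▸ cons_mem_conts _ _)))
    · rcases ihq _ _ _ _ hc h with h | h
      · exact Or.inl (Or.inr (Or.inr h))
      · exact Or.inr h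
  | loop i p ih =>
    intro k c σ c' hc h
    simp only [conts, List.mem_cons] at hc ⊢
    rcases hc with rfl | hc
    · simp only [step, Option.some.injEq] at h
      subst h
      dsimp only
      split_ifs
      · exact Or.inr rfl
      · exact Or.inl (Or.inr (cons_mem_conts _ _))
    · rcases ih _ _ _ _ hc h with h | h
      · exact Or.inl (Or.inr h)
      · exact Or.inl (Or.inl h)

/-- A strict upper bound for the registers occurring in a program. -/
def bound : RegProg → ℕ
  | inc i => i + 1
  | dec i => i + 1
  | seq p q => max (bound p) (bound q)
  | loop i p => max (i + 1) (bound p)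

theorem bound_step {b : ℕ} {c c' : List RegProg × (ℕ → ℕ)} (hb : ∀ q ∈ c.1, bound q ≤ b)
    (h : step c = some c') : ∀ q ∈ c'.1, bound q ≤ b := by
  obtain ⟨_ | ⟨p, k⟩, σ⟩ := c
  · simp [step] at h
  · simp only [List.mem_cons, forall_eq_or_imp] at hb
    obtain ⟨hp, hk⟩ := hb
    cases p <;> simp only [step, Option.some.injEq] at h <;> subst h
    · exact hk
    · exact hk
    · simp only [bound, max_le_iff] at hp
      simpa [hp] using hk
    · dsimp only
      split_ifs
      · exact hk
      · simp only [List.mem_cons, forall_eq_or_imp]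
        exact ⟨(max_le_iff.1 hp).2, hp, hk⟩

/-- The Gödel number of the registers below `b`, for the primes `pr`. -/
def godel (pr : ℕ → ℕ) (b : ℕ) (σ : ℕ → ℕ) : ℕ := ∏ i ∈ Finset.range b, pr i ^ σ i

theorem dvd_godel_iff {pr : ℕ → ℕ} (hpr : ∀ i, (pr i).Prime) (hinj : Injective pr) {b i : ℕ}
    (hi : i < b) (σ : ℕ → ℕ) : pr i ∣ godel pr b σ ↔ σ i ≠ 0 := by
  rw [godel, (hpr i).prime.dvd_finsetProd_iff]
  constructor
  · rintro ⟨j, _, h⟩ h0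
    have := hinj ((Nat.prime_dvd_prime_iff_eq (hpr i) (hpr j)).1 ((hpr i).dvd_of_dvd_pow h))
    subst this
    rw [h0, pow_zero] at h
    exact (hpr i).one_lt.ne' (Nat.dvd_one.1 h)
  · exact fun h => ⟨i, Finset.mem_range.2 hi, dvd_pow_self _ h⟩

theorem godel_update_succ (pr : ℕ → ℕ) {b i : ℕ} (hi : i < b) (σ : ℕ → ℕ) :
    godel pr b (update σ i (σ i + 1)) = pr i * godel pr b σ := by
  rw [godel, godel, ← Finset.mul_prod_erase _ _ (Finset.mem_range.2 hi),
    ← Finset.mul_prod_erase _ (fun j => pr j ^ σ j) (Finset.mem_range.2 hi), update_self,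
    pow_succ', mul_assoc]
  congr 2
  refine Finset.prod_congr rfl fun j hj => ?_
  rw [update_of_ne (Finset.ne_of_mem_erase hj)]

theorem godel_update_pred {pr : ℕ → ℕ} (hpr : ∀ i, (pr i).Prime) {b i : ℕ} (hi : i < b)
    {σ : ℕ → ℕ} (h : σ i ≠ 0) :
    godel pr b (update σ i (σ i - 1)) = godel pr b σ / pr i := by
  have h1 := godel_update_succ pr hi (update σ i (σ i - 1))
  have h2 : update (update σ i (σ i - 1)) i (update σ i (σ i - 1) i + 1) = σ := by
    rw [update_self, Nat.sub_add_cancel (Nat.pos_of_ne_zero h), update_idem, update_eq_self]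
  rw [h2] at h1
  rw [h1, Nat.mul_div_cancel_left _ (hpr i).pos]

/-- The divisors of the residue machine: `1`, followed by the primes `pr`. -/
def divisor (pr : ℕ → ℕ) : ℕ → ℕ
  | 0 => 1
  | i + 1 => pr i

open Classical in
/-- The residue machine simulating the programs on the stacks in `L`. -/
noncomputable def machine (L : List (List RegProg)) (b : ℕ) (pr : ℕ → ℕ)
    (hpr : ∀ i, (pr i).Prime) (hmod : ∀ i, pr i ≡ 1 [MOD 2 ^ (2 * L.length) * 3 ^ (b + 2)]) :
    ResidueMachine where
  P := ∏ i ∈ Finset.range b, pr i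
  M := 2 ^ (2 * L.length)
  R := 3 ^ (b + 2)
  S := L.length
  d := divisor pr
  act s u := match L.getD s [] with
    | [] => none
    | inc i :: k => some (L.idxOf k, pr i, 0)
    | dec i :: k => some (L.idxOf k, 1, if i < b ∧ pr i ∣ u then i + 1 else 0)
    | seq p q :: k => some (L.idxOf (p :: q :: k), 1, 0)
    | loop i p :: k => some (L.idxOf (if pr i ∣ u then p :: loop i p :: k else k), 1, 0)
  P_pos := Finset.prod_pos fun i _ => (hpr i).pos
  one_lt_R := Nat.one_lt_pow (by omega) (by omega)
  S_le := Nat.lt_two_pow_self.le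
  M_pos := by positivity
  coprime_PM := Nat.Coprime.prod_left fun i _ => by
    rw [Nat.Coprime, ((hmod i).of_mul_right _).gcd_eq, Nat.gcd_one_left]
  coprime_PR := Nat.Coprime.prod_left fun i _ => by
    rw [Nat.Coprime, ((hmod i).of_mul_left _).gcd_eq, Nat.gcd_one_left]
  coprime_MR := Nat.Coprime.pow _ _ (by norm_num)
  d_zero := rfl
  act_spec s u s' a f h := by
    have hR : b + 2 < 3 ^ (b + 2) := Nat.lt_pow_self (by norm_num)
    split at h
    · simp at h
    · obtain ⟨_, _, rfl⟩ := by simpa using h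
      exact ⟨by omega, one_dvd _⟩
    · simp only [Option.some.injEq, Prod.mk.injEq] at h
      obtain ⟨_, _, rfl⟩ := h
      split_ifs with hi
      · exact ⟨by omega, Finset.dvd_prod_of_mem pr (Finset.mem_range.2 hi.1)⟩
      · exact ⟨by omega, one_dvd _⟩
    · obtain ⟨_, _, rfl⟩ := by simpa using h
      exact ⟨by omega, one_dvd _⟩
    · obtain ⟨_, _, rfl⟩ := by simpa using h
      exact ⟨by omega, one_dvd _⟩

open Classical in
theorem machine_step {L : List (List RegProg)} {b : ℕ} {pr : ℕ → ℕ}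
    (hpr : ∀ i, (pr i).Prime) (hmod : ∀ i, pr i ≡ 1 [MOD 2 ^ (2 * L.length) * 3 ^ (b + 2)])
    (hinj : Injective pr) {k : List RegProg} (σ : ℕ → ℕ) (hk : k ∈ L)
    (hb : ∀ q ∈ k, bound q ≤ b) :
    (machine L b pr hpr hmod).step (L.idxOf k, godel pr b σ) =
      (step (k, σ)).map fun c => (L.idxOf c.1, godel pr b c.2) := by
  have hL : L.getD (L.idxOf k) [] = k := by
    rw [List.getD_eq_getElem _ _ (List.idxOf_lt_length_of_mem hk), List.getElem_idxOf]
  have hdvd : ∀ i < b, (pr i ∣ godel pr b σ % ∏ i ∈ Finset.range b, pr i) ↔ σ i ≠ 0 := by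
    intro i hi
    rw [Nat.dvd_mod_iff (Finset.dvd_prod_of_mem pr (Finset.mem_range.2 hi)),
      dvd_godel_iff hpr hinj hi]
  simp only [ResidueMachine.step, machine, hL]
  rcases k with _ | ⟨p, k⟩
  · rfl
  · have hp : bound p ≤ b := hb p (by simp)
    cases p with
    | inc i =>
      simp only [step, Option.map_some, divisor, Nat.div_one]
      rw [godel_update_succ pr hp]
    | dec i =>
      simp only [step, Option.map_some, one_mul, hdvd i hp]
      by_cases h : σ i = 0
      · have h2 : update σ i (σ i - 1) = σ := by
          rw [h, Nat.zero_sub, ← h, update_eq_self]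
        rw [h2]
        simp [h, divisor]
      · have hp' : i < b := hp
        simp [h, hp', divisor, godel_update_pred hpr hp' h]
    | seq p q => simp [step, divisor]
    | loop i p =>
      have hp' : i < b := lt_of_lt_of_le (Nat.lt_succ_self i) ((le_max_left _ _).trans hp)
      simp only [step, Option.map_some, one_mul, hdvd i hp', divisor, Nat.div_one]
      by_cases h : σ i = 0 <;> simp [h]

theorem exists_residueMachine (p : RegProg) :
    ∃ (T : ResidueMachine) (a : ℕ) (Inv : ℕ × ℕ → Prop),
      (∀ c, Inv c → c.1 < T.S ∧ 0 < c.2 ∧ c.2 ≡ 1 [MOD T.M]) ∧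
      (∀ c c', Inv c → T.step c = some c' → Inv c') ∧
      ∀ n, Inv (0, a ^ n) ∧
        ((∃ c, ReflTransGen (fun a b => T.step a = some b) (0, a ^ n) c ∧ T.step c = none) ↔
          ∃ e, ReflTransGen (fun a b => step a = some b) ([p], update (fun _ => 0) 0 n) e ∧
            step e = none) := by
  classical
  let L := conts p [] ++ [[]]
  let b := max 1 p.bound
  obtain ⟨pr, hmono, hpr'⟩ := Filter.extraction_of_frequently_atTop
    (Nat.frequently_atTop_modEq_one (k := 2 ^ (2 * L.length) * 3 ^ (b + 2)) (by positivity))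
  have hpr := fun i => (hpr' i).1
  have hmod := fun i => (hpr' i).2
  let T := machine L b pr hpr hmod
  let Good : List RegProg × (ℕ → ℕ) → Prop := fun c => c.1 ∈ L ∧ ∀ q ∈ c.1, bound q ≤ b
  let enc : List RegProg × (ℕ → ℕ) → ℕ × ℕ := fun c => (L.idxOf c.1, godel pr b c.2)
  have hsim : ∀ c, Good c → T.step (enc c) = (step c).map enc := fun c hc =>
    machine_step hpr hmod hmono.injective c.2 hc.1 hc.2
  have hgood : ∀ c c', Good c → step c = some c' → Good c' := by
    intro c c' hc h
    refine ⟨?_, bound_step hc.2 h⟩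
    rcases List.mem_append.1 hc.1 with h1 | h1
    · rcases step_mem_conts p [] c.1 c.2 c' h1 h with h2 | h2
      · exact List.mem_append_left _ h2
      · exact List.mem_append_right _ (by simp [h2])
    · obtain ⟨k, σ⟩ := c
      obtain rfl : k = [] := by simpa using h1
      simp [step] at h
  have hinit : ∀ σ, Good ([p], σ) := fun σ =>
    ⟨List.mem_append_left _ (cons_mem_conts p []), by simp [b]⟩
  have henc : ∀ n, enc ([p], update (fun _ => 0) 0 n) = (0, pr 0 ^ n) := by
    intro n
    refine Prod.ext ?_ ?_
    · have h := head?_conts p []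
      rcases hL : conts p [] with _ | ⟨x, l⟩
      · simp [hL] at h
      · rw [hL] at h
        simp only [List.head?_cons, Option.some.injEq] at h
        simp [enc, L, hL, h]
    · have h0 : 0 ∈ Finset.range b := Finset.mem_range.2 (by simp [b])
      simp only [enc, godel]
      rw [Finset.prod_eq_single_of_mem 0 h0, update_self]
      intro j _ hj
      rw [update_of_ne hj, pow_zero]
  refine ⟨T, pr 0, fun c => ∃ c', Good c' ∧ c = enc c', ?_, ?_, fun n => ⟨?_, ?_⟩⟩
  · rintro _ ⟨c, hc, rfl⟩
    have hM : godel pr b c.2 ≡ 1 [MOD 2 ^ (2 * L.length)] := by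
      unfold godel
      induction Finset.range b using Finset.induction_on with
      | empty => rfl
      | insert i s hi ih =>
        rw [Finset.prod_insert hi]
        simpa using (((hmod i).of_mul_right _).pow (c.2 i)).mul ih
    have hpos : 0 < godel pr b c.2 := Finset.prod_pos fun i _ => pow_pos (hpr i).pos _
    exact ⟨List.idxOf_lt_length_of_mem hc.1, hpos, hM⟩
  · rintro _ d ⟨c, hc, rfl⟩ h
    rw [hsim c hc] at h
    obtain ⟨c', h1, rfl⟩ := Option.map_eq_some_iff.1 h
    exact ⟨c', hgood c c' hc h1, rfl⟩
  · exact ⟨_, hinit _, (henc n).symm⟩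
  · rw [← henc n]
    constructor
    · rintro ⟨d, hd, hn⟩
      have : ∃ e, Good e ∧ d = enc e ∧ ReflTransGen (fun a b => step a = some b)
          ([p], update (fun _ => 0) 0 n) e := by
        clear hn
        induction hd with
        | refl => exact ⟨_, hinit _, rfl, .refl⟩
        | tail _ h ih =>
          obtain ⟨e, he, rfl, hr⟩ := ih
          rw [hsim e he] at h
          obtain ⟨e', h1, rfl⟩ := Option.map_eq_some_iff.1 h
          exact ⟨e', hgood e e' he h1, rfl, hr.tail h1⟩
      obtain ⟨e, he, rfl, hr⟩ := this
      rw [hsim e he] at hn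
      exact ⟨e, hr, Option.map_eq_none_iff.1 hn⟩
    · rintro ⟨e, hr, hn⟩
      have : Good e ∧ ReflTransGen (fun a b => T.step a = some b)
          (enc ([p], update (fun _ => 0) 0 n)) (enc e) := by
        clear hn
        induction hr with
        | refl => exact ⟨hinit _, .refl⟩
        | tail _ h ih =>
          refine ⟨hgood _ _ ih.1 h, ih.2.tail ?_⟩
          rw [hsim _ ih.1, h]
          rfl
      exact ⟨enc e, this.2, by rw [hsim e this.1, hn]; rfl⟩

end RegProg

open Nat.Partrec in
theorem exists_undecidable_search :
    ∃ g : ℕ → ℕ → ℕ, Primrec₂ g ∧ ¬ ComputablePred fun n => ∃ j, g n j = 0 := by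
  refine ⟨fun n j => if ((Denumerable.ofNat Code n).evaln j 0).isSome then 0 else 1, ?_, ?_⟩
  · refine Primrec.ite (Primrec.eq.comp (Primrec.option_isSome.comp (Code.primrec_evaln.comp
      ((Primrec.snd.pair ((Primrec.ofNat Code).comp Primrec.fst)).pair (Primrec.const 0))))
      (Primrec.const true)) (Primrec.const 0) (Primrec.const 1)
  · intro h
    refine ComputablePred.halting_problem 0 ?_
    have h2 : ComputablePred fun c : Code =>
        ∃ j, (if ((Denumerable.ofNat Code (Encodable.encode c)).evaln j 0).isSome
          then 0 else 1) = 0 :=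
      ComputablePred.computable_of_manyOneReducible
        ⟨Encodable.encode, Computable.encode, fun _ => Iff.rfl⟩ h
    refine h2.of_eq fun c => ?_
    simp only [Denumerable.ofNat_encode, ite_eq_left_iff, one_ne_zero, imp_false, not_not]
    rw [Part.dom_iff_mem]
    simp only [Code.evaln_complete, Option.isSome_iff_exists, Option.mem_def]
    exact exists_comm

theorem not_computablePred_posSemidef {d r : ℕ} (hd : 6 ≤ d) (hr : 6 ≤ r) :
    ¬ ComputablePred (fun ρ : Fin r → Fin r → Fin d → Fin d → ℚ × ℚ =>
      ∀ n, (tauMat (fun α β => toMatC (ρ α β)) n).PosSemidef) := by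
  obtain ⟨g, hg, hK⟩ := exists_undecidable_search
  obtain ⟨p, hp⟩ := RegProg.exists_halts_iff hg
  obtain ⟨T, a, Inv, h1, h2, h3⟩ := RegProg.exists_residueMachine p
  have hm : 0 < T.P * T.M * T.R :=
    Nat.mul_pos (Nat.mul_pos T.P_pos T.M_pos) (by have := T.one_lt_R; omega)
  obtain ⟨X, hX, hXe⟩ := exists_bitQueue_of_token hm T.words_periodic
  refine not_computablePred_of_bitQueue hd hr hm X hX (fun n => a ^ n)
    (primrec_const_pow a Primrec.id) _ hK fun n => ?_
  rw [hXe, T.exists_nil_iff_halts Inv h1 h2 _ (h3 n).1, (h3 n).2, hp n]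

end TauUndec


/-- For `d, r ≥ 7` it is undecidable whether `τ_n(ρ)` is positive semidefinite for all
`n ≥ 1`, for tuples `ρ = (ρ_{α,β})` of `d × d` matrices with Gaussian-rational entries. -/
theorem tau_posSemidef_undecidable (d r : ℕ) (hd : 7 ≤ d) (hr : 7 ≤ r) :
    ¬ ComputablePred (fun ρ : Fin r → Fin r → Fin d → Fin d → ℚ × ℚ =>
        ∀ n : ℕ, (tauMat (fun α β => toMatC (ρ α β)) n).PosSemidef) := by
  exact TauUndec.not_computablePred_posSemidef (by omega) (by omega)
end

section
/- The purification rank cannot be upper bounded by any function of the operator Schmidt rank alone: for every function f : ℕ → ℕ there exist d ∈ ℕ and a positive semidefinite matrix ρ ∈ Her_d ⊗ Her_d ≅ Her_{d²} such that puri-rank(ρ) > f(osr(ρ)). -/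
open Matrix
open scoped Kronecker ComplexOrder

/-- The operator Schmidt rank of `ρ ∈ Mat_d ⊗ Mat_d`: the minimal number of terms in a
decomposition `ρ = Σᵢ aᵢ ⊗ bᵢ` with `aᵢ, bᵢ ∈ Mat_d(ℂ)`. -/
noncomputable def osr {d : ℕ} (ρ : Matrix (Fin d × Fin d) (Fin d × Fin d) ℂ) : ℕ :=
  sInf {r | ∃ a b : Fin r → Matrix (Fin d) (Fin d) ℂ, ρ = ∑ i, a i ⊗ₖ b i}

/-- The purification rank of `ρ`: the minimal `r` such that `ρ = ξξ*` for some
`ξ = Σᵢ aᵢ ⊗ bᵢ` with `aᵢ ∈ Mat_{d,e}(ℂ)`, `bᵢ ∈ Mat_{d,f}(ℂ)`, `i = 1, …, r`. -/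
noncomputable def puriRank {d : ℕ} (ρ : Matrix (Fin d × Fin d) (Fin d × Fin d) ℂ) : ℕ :=
  sInf {r | ∃ (e f : ℕ) (a : Fin r → Matrix (Fin d) (Fin e) ℂ)
    (b : Fin r → Matrix (Fin d) (Fin f) ℂ),
    ρ = (∑ i, a i ⊗ₖ b i) * (∑ i, a i ⊗ₖ b i)ᴴ}

open Module in
/-- Any finite family in a finite-dimensional space is spanned by a subfamily with at most
`finrank` members. -/
theorem exists_subfamily_coeff {K E ι : Type*} [DivisionRing K] [AddCommGroup E] [Module K E]
    [FiniteDimensional K E] (v : ι → E) :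
    ∃ m ≤ finrank K E, ∃ (s : Fin m → ι) (c : ι → Fin m → K), ∀ i, v i = ∑ l, c i l • v (s l) := by
  obtain ⟨g, hg, hspan, -⟩ := Submodule.exists_fun_fin_finrank_span_eq K (Set.range v)
  choose s hs using hg
  have hmem : ∀ i, ∃ c : Fin (finrank K (Submodule.span K (Set.range v))) → K,
      ∑ l, c l • g l = v i := fun i => by
    rw [← Submodule.mem_span_range_iff_exists_fun, hspan]
    exact Submodule.subset_span ⟨i, rfl⟩
  choose c hc using hmem
  exact ⟨_, Submodule.finrank_le _, s, c, fun i => by simp only [hs, hc]⟩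

/-- `α` is the Gram matrix, written as a function of pairs, of finitely many vectors. -/
def IsGram {κ : Type*} (α : κ × κ → ℂ) : Prop :=
  ∃ (e : ℕ) (a : κ → Fin e → ℂ), ∀ p, α p = ∑ u, a p.1 u * star (a p.2 u)

theorem sum_gram_mul_gram {κ : Type*} [Fintype κ] {e f : ℕ} (a : κ → Fin e → ℂ)
    (b : κ → Fin f → ℂ) :
    ∑ p : κ × κ, (∑ u, a p.1 u * star (a p.2 u)) * (∑ v, b p.1 v * star (b p.2 v)) =
      ∑ w : Fin e × Fin f, (∑ k, a k w.1 * b k w.2) * star (∑ k, a k w.1 * b k w.2) := by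
  simp only [star_sum, star_mul', Finset.sum_mul_sum, Fintype.sum_prod_type]
  calc _ = ∑ k, ∑ u, ∑ l, ∑ v, a k u * star (a l u) * (b k v * star (b l v)) :=
        Finset.sum_congr rfl fun k _ => Finset.sum_comm
    _ = ∑ u, ∑ k, ∑ v, ∑ l, a k u * star (a l u) * (b k v * star (b l v)) := by
        rw [Finset.sum_comm]
        exact Finset.sum_congr rfl fun u _ => Finset.sum_congr rfl fun k _ => Finset.sum_comm
    _ = _ := by
        refine Finset.sum_congr rfl fun u _ => ?_
        rw [Finset.sum_comm]
        refine Finset.sum_congr rfl fun v _ => Finset.sum_congr rfl fun k _ =>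
          Finset.sum_congr rfl fun l _ => ?_
        ring

theorem IsGram.re_sum_mul_nonneg {κ : Type*} [Fintype κ] {α β : κ × κ → ℂ} (hα : IsGram α)
    (hβ : IsGram β) : 0 ≤ (∑ p, α p * β p).re := by
  obtain ⟨e, a, ha⟩ := hα
  obtain ⟨f, b, hb⟩ := hβ
  simp only [ha, hb, sum_gram_mul_gram, Complex.re_sum]
  refine Finset.sum_nonneg fun w _ => ?_
  rw [Complex.star_def, Complex.mul_conj]
  exact_mod_cast Complex.normSq_nonneg _

/-- The slack matrix of the points `(j, j² + δ j)` with respect to the lines of slope `2i`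
through `(i, i² + δ i)`. -/
def slack {n : ℕ} (δ : Fin n → ℝ) (i j : Fin n) : ℝ := ((i : ℝ) - j) ^ 2 + δ j - δ i

theorem slack_self {n : ℕ} (δ : Fin n → ℝ) (i : Fin n) : slack δ i i = 0 := by simp [slack]

theorem slack_nonneg {n : ℕ} {δ : Fin n → ℝ} (hδ : δ ∈ Metric.ball (0 : Fin n → ℝ) (1 / 2))
    (i j : Fin n) : 0 ≤ slack δ i j := by
  rcases eq_or_ne i j with rfl | hij
  · rw [slack_self]
  have habs : ∀ i, |δ i| < 1 / 2 := fun i =>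
    (norm_le_pi_norm δ i).trans_lt (mem_ball_zero_iff.mp hδ)
  have hsq : (1 : ℝ) ≤ ((i : ℝ) - j) ^ 2 := by
    have hne : ((i : ℕ) : ℤ) - (j : ℕ) ≠ 0 := by
      rw [sub_ne_zero]
      exact_mod_cast Fin.val_ne_of_ne hij
    have : (1 : ℤ) ≤ (((i : ℕ) : ℤ) - (j : ℕ)) ^ 2 := Int.add_one_le_iff.mpr (sq_pos_of_ne_zero hne)
    exact_mod_cast this
  have hi := abs_lt.mp (habs i)
  have hj := abs_lt.mp (habs j)
  unfold slack
  linarith [hi.2, hj.1]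

/-- `α`, `β` is a factorization of size `r` of `slack δ` through positive semidefinite
matrices. -/
structure IsPSDFactorization {n r : ℕ} (δ : Fin n → ℝ) (α β : Fin n → Fin r × Fin r → ℂ) :
    Prop where
  left : ∀ i, IsGram (α i)
  right : ∀ j, IsGram (β j)
  sum_mul : ∀ i j, ∑ p, α i p * β j p = (slack δ i j : ℂ)

/-- The left factors of a factorization of `slack δ`, together with the data of the lines. -/
def liftVector {n r : ℕ} (δ : Fin n → ℝ) (α : Fin n → Fin r × Fin r → ℂ) (i : Fin n) :
    (Fin r × Fin r → ℂ) × ℂ × ℂ × ℂ :=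
  (α i, 1, (i : ℂ), (i : ℂ) ^ 2 - δ i)

/-- The parameters `δ` whose slack matrix has a factorization with right factors bounded by `R` and
such that the left factors with indices in `s` span the others with coefficients bounded
by `R`. -/
def factorizable {n m : ℕ} (r : ℕ) (s : Fin m → Fin n) (R : ℕ) : Set (Fin n → ℝ) :=
  {δ | ∃ (α β : Fin n → Fin r × Fin r → ℂ) (c : Fin n → Fin m → ℂ), IsPSDFactorization δ α β ∧
    (∀ i, liftVector δ α i = ∑ l, c i l • liftVector δ α (s l)) ∧
    (∀ i l, ‖c i l‖ ≤ R) ∧ ∀ j p, ‖β j p‖ ≤ R}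

/-- The parameter is controlled by the part of the factorization that is indexed by `s`. -/
theorem sub_le_of_factorizations {n m r R : ℕ} {s : Fin m → Fin n} {δ δ' : Fin n → ℝ}
    {α α' β β' : Fin n → Fin r × Fin r → ℂ} {c : Fin n → Fin m → ℂ} {η : ℝ}
    (h : IsPSDFactorization δ α β) (h' : IsPSDFactorization δ' α' β')
    (hspan : ∀ i, liftVector δ α i = ∑ l, c i l • liftVector δ α (s l))
    (hc : ∀ i l, ‖c i l‖ ≤ R) (hβ' : ∀ j p, ‖β' j p‖ ≤ R)
    (hα : ∀ l p, ‖α (s l) p - α' (s l) p‖ ≤ η) (hδ : ∀ l, |δ (s l) - δ' (s l)| ≤ η) (j : Fin n) :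
    δ j - δ' j ≤ m * (R * (r * r * (η * R) + η)) := by
  set E : Fin m → ℂ := fun l =>
    ∑ p, (α (s l) p - α' (s l) p) * β' j p + ((δ (s l) - δ' (s l) : ℝ) : ℂ) with hE
  have hEle : ∀ l, ‖E l‖ ≤ r * r * (η * R) + η := fun l => by
    refine (norm_add_le _ _).trans (add_le_add ?_ ?_)
    · refine (norm_sum_le_of_le _ (f := fun p => (α (s l) p - α' (s l) p) * β' j p)
        (n := fun _ => η * R) fun p _ => ?_).trans ?_
      · rw [norm_mul]
        exact mul_le_mul (hα l p) (hβ' j p) (norm_nonneg _) ((norm_nonneg _).trans (hα l p))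
      · simp
    · rw [Complex.norm_real]
      exact hδ l
  have hα_span : ∀ p, α j p = ∑ l, c j l * α (s l) p := fun p => by
    simpa [liftVector, Prod.fst_sum] using congrFun (congrArg Prod.fst (hspan j)) p
  have hone : (1 : ℂ) = ∑ l, c j l := by
    simpa [liftVector, Prod.fst_sum, Prod.snd_sum] using congrArg (fun x => x.2.1) (hspan j)
  have hid : (j : ℂ) = ∑ l, c j l * (s l : ℂ) := by
    simpa [liftVector, Prod.fst_sum, Prod.snd_sum] using congrArg (fun x => x.2.2.1) (hspan j)
  have hsq : (j : ℂ) ^ 2 - δ j = ∑ l, c j l * ((s l : ℂ) ^ 2 - δ (s l)) := by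
    simpa [liftVector, Prod.fst_sum, Prod.snd_sum] using congrArg (fun x => x.2.2.2) (hspan j)
  have hpair : ∀ l, ∑ p, α (s l) p * β' j p =
      ((s l : ℂ) ^ 2 - δ (s l)) - 2 * j * (s l : ℂ) + ((j : ℂ) ^ 2 + δ' j) + E l := fun l => by
    have h1 := h'.sum_mul (s l) j
    have h2 : ∑ p, α (s l) p * β' j p =
        ∑ p, (α (s l) p - α' (s l) p) * β' j p + ∑ p, α' (s l) p * β' j p := by
      rw [← Finset.sum_add_distrib]
      exact Finset.sum_congr rfl fun p _ => by ring
    rw [h2, h1, hE]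
    simp only [slack]
    push_cast
    ring
  have hmixed : ∑ p, α j p * β' j p = (δ' j - δ j : ℝ) + ∑ l, c j l * E l := by
    calc ∑ p, α j p * β' j p = ∑ l, c j l * ∑ p, α (s l) p * β' j p := by
          simp only [hα_span, Finset.sum_mul, Finset.mul_sum]
          rw [Finset.sum_comm]
          exact Finset.sum_congr rfl fun l _ => Finset.sum_congr rfl fun p _ => by ring
      _ = ∑ l, (c j l * ((s l : ℂ) ^ 2 - δ (s l)) - 2 * j * (c j l * (s l : ℂ)) +
            ((j : ℂ) ^ 2 + δ' j) * c j l + c j l * E l) :=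
          Finset.sum_congr rfl fun l _ => by rw [hpair l]; ring
      _ = _ := by
          rw [Finset.sum_add_distrib, Finset.sum_add_distrib, Finset.sum_sub_distrib,
            ← Finset.mul_sum, ← Finset.mul_sum, ← hsq, ← hid, ← hone]
          push_cast
          ring
  have hnonneg := (h.left j).re_sum_mul_nonneg (h'.right j)
  rw [hmixed, Complex.add_re, Complex.ofReal_re] at hnonneg
  have hbound : ‖∑ l, c j l * E l‖ ≤ m * (R * (r * r * (η * R) + η)) := by
    refine (norm_sum_le_of_le _ (f := fun l => c j l * E l)
      (n := fun _ => R * (r * r * (η * R) + η)) fun l _ => ?_).trans (by simp)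
    rw [norm_mul]
    exact mul_le_mul (hc j l) (hEle l) (norm_nonneg _) R.cast_nonneg
  linarith [(Complex.re_le_norm _).trans hbound]

theorem dimH_factorizable_le {n m : ℕ} (r : ℕ) (s : Fin m → Fin n) (R : ℕ) :
    dimH (factorizable r s R) ≤ (m * (2 * (r * r) + 1) : ℕ) := by
  classical
  choose! α β c hfac hspan hc hβ using fun δ (hδ : δ ∈ factorizable r s R) => hδ
  let g : (Fin n → ℝ) → (Fin m → (Fin r × Fin r → ℂ) × ℝ) := fun δ l => (α δ (s l), δ (s l))
  have hg : ∀ δ ∈ factorizable r s R, ∀ δ' ∈ factorizable r s R,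
      dist δ δ' ≤ m * (R * (r * r * R + 1)) * dist (g δ) (g δ') := by
    have hle : ∀ δ ∈ factorizable r s R, ∀ δ' ∈ factorizable r s R, ∀ j,
        δ j - δ' j ≤ m * (R * (r * r * R + 1)) * dist (g δ) (g δ') := fun δ hδ δ' hδ' j => by
      have hdist : ∀ l, dist (g δ l) (g δ' l) ≤ dist (g δ) (g δ') := dist_le_pi_dist _ _
      refine (sub_le_of_factorizations (η := dist (g δ) (g δ')) (hfac δ hδ) (hfac δ' hδ')
        (hspan δ hδ) (hc δ hδ) (hβ δ' hδ') (fun l p => ?_) (fun l => ?_) j).trans_eq (by ring)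
      · rw [← dist_eq_norm]
        exact (dist_le_pi_dist (α δ (s l)) (α δ' (s l)) p).trans
          ((le_max_left _ _).trans (hdist l))
      · exact (le_max_right _ _).trans (hdist l)
    refine fun δ hδ δ' hδ' => (dist_pi_le_iff (by positivity)).mpr fun j => ?_
    rw [Real.dist_eq, abs_sub_le_iff]
    exact ⟨hle δ hδ δ' hδ' j, by rw [dist_comm]; exact hle δ' hδ' δ hδ j⟩
  have hinj : Set.InjOn g (factorizable r s R) := fun δ hδ δ' hδ' heq =>
    dist_le_zero.mp ((hg δ hδ δ' hδ').trans_eq (by simp [heq]))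
  have hlip : LipschitzOnWith (m * (R * (r * r * R + 1)))
      (Function.invFunOn g (factorizable r s R)) (g '' factorizable r s R) := by
    refine LipschitzOnWith.of_dist_le_mul ?_
    rintro _ ⟨δ, hδ, rfl⟩ _ ⟨δ', hδ', rfl⟩
    rw [hinj.leftInvOn_invFunOn hδ, hinj.leftInvOn_invFunOn hδ']
    simpa using hg δ hδ δ' hδ'
  calc dimH (factorizable r s R)
      = dimH (Function.invFunOn g (factorizable r s R) '' (g '' factorizable r s R)) := by
        rw [hinj.leftInvOn_invFunOn.image_image]
    _ ≤ dimH (g '' factorizable r s R) := hlip.dimH_image_le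
    _ ≤ dimH (Set.univ : Set (Fin m → (Fin r × Fin r → ℂ) × ℝ)) := dimH_mono (Set.subset_univ _)
    _ = (m * (2 * (r * r) + 1) : ℕ) := by
        rw [Real.dimH_univ_eq_finrank]
        congr 1
        simp [Module.finrank_pi_fintype, mul_comm]

theorem dimH_setOf_psdFactorization_le (n r : ℕ) :
    dimH {δ : Fin n → ℝ | ∃ α β : Fin n → Fin r × Fin r → ℂ, IsPSDFactorization δ α β} ≤
      ((r * r + 3) * (2 * (r * r) + 1) : ℕ) := by
  have hsub : {δ : Fin n → ℝ | ∃ α β : Fin n → Fin r × Fin r → ℂ, IsPSDFactorization δ α β} ⊆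
      ⋃ x : (Σ m : Fin (r * r + 4), Fin m → Fin n) × ℕ, factorizable r x.1.2 x.2 := by
    rintro δ ⟨α, β, h⟩
    obtain ⟨m, hm, s, c, hspan⟩ := exists_subfamily_coeff (K := ℂ) (liftVector δ α)
    obtain ⟨R₁, hR₁⟩ := exists_nat_ge (∑ i, ∑ l, ‖c i l‖)
    obtain ⟨R₂, hR₂⟩ := exists_nat_ge (∑ j, ∑ p, ‖β j p‖)
    have hm' : m < r * r + 4 := by
      simp only [Module.finrank_prod, Module.finrank_fintype_fun_eq_card, Fintype.card_prod,
        Fintype.card_fin, Module.finrank_self] at hm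
      omega
    refine Set.mem_iUnion.mpr ⟨(⟨⟨m, hm'⟩, s⟩, max R₁ R₂), α, β, c, h, hspan, fun i l => ?_,
      fun j p => ?_⟩
    · calc ‖c i l‖ ≤ ∑ l, ‖c i l‖ :=
            Finset.single_le_sum (f := fun l => ‖c i l‖) (fun _ _ => norm_nonneg _)
              (Finset.mem_univ l)
        _ ≤ ∑ i, ∑ l, ‖c i l‖ :=
            Finset.single_le_sum (f := fun i => ∑ l, ‖c i l‖)
              (fun _ _ => Finset.sum_nonneg fun _ _ => norm_nonneg _) (Finset.mem_univ i)
        _ ≤ (max R₁ R₂ : ℕ) := hR₁.trans (by exact_mod_cast le_max_left _ _)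
    · calc ‖β j p‖ ≤ ∑ p, ‖β j p‖ :=
            Finset.single_le_sum (f := fun p => ‖β j p‖) (fun _ _ => norm_nonneg _)
              (Finset.mem_univ p)
        _ ≤ ∑ j, ∑ p, ‖β j p‖ :=
            Finset.single_le_sum (f := fun j => ∑ p, ‖β j p‖)
              (fun _ _ => Finset.sum_nonneg fun _ _ => norm_nonneg _) (Finset.mem_univ j)
        _ ≤ (max R₁ R₂ : ℕ) := hR₂.trans (by exact_mod_cast le_max_right _ _)
  refine (dimH_mono hsub).trans ?_
  rw [dimH_iUnion]
  refine iSup_le fun x => (dimH_factorizable_le r x.1.2 x.2).trans ?_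
  exact_mod_cast Nat.mul_le_mul_right _ (Nat.lt_succ_iff.mp x.1.1.2)

/-- For every `N` there is a nonnegative slack matrix without positive semidefinite factorization
of size at most `N`. -/
theorem exists_slack_forall_not_psdFactorization (N : ℕ) :
    ∃ (n : ℕ) (δ : Fin n → ℝ), (∀ i j, 0 ≤ slack δ i j) ∧
      ∀ r ≤ N, ∀ α β : Fin n → Fin r × Fin r → ℂ, ¬ IsPSDFactorization δ α β := by
  set D := (N * N + 3) * (2 * (N * N) + 1)
  by_contra! hcon
  have hsub : Metric.ball (0 : Fin (D + 1) → ℝ) (1 / 2) ⊆ ⋃ r : Fin (N + 1),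
      {δ | ∃ α β : Fin (D + 1) → Fin r × Fin r → ℂ, IsPSDFactorization δ α β} := fun δ hδ => by
    obtain ⟨r, hr, h⟩ := hcon (D + 1) δ (slack_nonneg hδ)
    exact Set.mem_iUnion.mpr ⟨⟨r, Nat.lt_succ_iff.mpr hr⟩, h⟩
  have hle : dimH (Metric.ball (0 : Fin (D + 1) → ℝ) (1 / 2)) ≤ (D : ℕ) := by
    refine (dimH_mono hsub).trans ?_
    rw [dimH_iUnion]
    refine iSup_le fun r => (dimH_setOf_psdFactorization_le _ _).trans ?_
    have hr : (r : ℕ) ≤ N := Nat.lt_succ_iff.mp r.2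
    exact_mod_cast show (r * r + 3) * (2 * (r * r) + 1) ≤ (N * N + 3) * (2 * (N * N) + 1) by gcongr
  rw [Real.dimH_ball_pi_fin _ (by norm_num)] at hle
  exact absurd (by exact_mod_cast hle) (Nat.not_succ_le_self D)

/-- The diagonal matrix whose diagonal entries are the entries of `slack δ`. -/
noncomputable def slackState {n : ℕ} (δ : Fin n → ℝ) :
    Matrix (Fin n × Fin n) (Fin n × Fin n) ℂ :=
  diagonal fun x => (slack δ x.1 x.2 : ℂ)

theorem osr_slackState_le {n : ℕ} (δ : Fin n → ℝ) : osr (slackState δ) ≤ 3 := by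
  refine Nat.sInf_le ⟨![1, diagonal fun i => (i : ℂ) ^ 2 - δ i, diagonal fun i => -2 * (i : ℂ)],
    ![diagonal fun j => (j : ℂ) ^ 2 + δ j, 1, diagonal fun j => (j : ℂ)], ?_⟩
  simp only [Fin.sum_univ_three, Matrix.cons_val, ← diagonal_one, diagonal_kronecker_diagonal,
    diagonal_add, slackState]
  congr 1
  funext x
  simp only [slack]
  push_cast
  ring

theorem exists_purification_slackState {n : ℕ} {δ : Fin n → ℝ} (hδ : ∀ i j, 0 ≤ slack δ i j) :
    ∃ (r e f : ℕ) (a : Fin r → Matrix (Fin n) (Fin e) ℂ) (b : Fin r → Matrix (Fin n) (Fin f) ℂ),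
      slackState δ = (∑ i, a i ⊗ₖ b i) * (∑ i, a i ⊗ₖ b i)ᴴ := by
  let z : Fin n → Fin n → ℂ := fun i j => (Real.sqrt (slack δ i j) : ℂ)
  refine ⟨n, n, n, fun k => diagonal (Pi.single k 1), fun k => diagonal (z k), ?_⟩
  have hsum : ∑ k, diagonal (Pi.single k 1) ⊗ₖ diagonal (z k) =
      diagonal fun x : Fin n × Fin n => z x.1 x.2 := by
    ext x y
    simp [diagonal_kronecker_diagonal, Matrix.sum_apply, diagonal_apply, Pi.single_apply]
  rw [hsum, diagonal_conjTranspose, diagonal_mul_diagonal, slackState]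
  congr 1
  funext x
  simp only [z, Pi.star_apply, Complex.star_def, Complex.conj_ofReal]
  rw [← Complex.ofReal_mul, Real.mul_self_sqrt (hδ _ _)]

theorem exists_psdFactorization_of_purification {n r e f : ℕ} {δ : Fin n → ℝ}
    {a : Fin r → Matrix (Fin n) (Fin e) ℂ} {b : Fin r → Matrix (Fin n) (Fin f) ℂ}
    (h : slackState δ = (∑ i, a i ⊗ₖ b i) * (∑ i, a i ⊗ₖ b i)ᴴ) :
    ∃ α β : Fin n → Fin r × Fin r → ℂ, IsPSDFactorization δ α β := by
  refine ⟨fun i p => ∑ u, a p.1 i u * star (a p.2 i u),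
    fun j p => ∑ v, b p.1 j v * star (b p.2 j v), fun i => ⟨e, fun k => a k i, fun _ => rfl⟩,
    fun j => ⟨f, fun k => b k j, fun _ => rfl⟩, fun i j => ?_⟩
  have hij := congrFun (congrFun h (i, j)) (i, j)
  simp only [slackState, diagonal_apply_eq, mul_apply, conjTranspose_apply, Matrix.sum_apply,
    kroneckerMap_apply] at hij
  rw [hij]
  exact sum_gram_mul_gram (fun k => a k i) (fun k => b k j)

/-- The purification rank cannot be upper bounded by any function of the operator
Schmidt rank alone. -/
theorem puriRank_not_bounded_by_osr (f : ℕ → ℕ) :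
    ∃ (d : ℕ) (ρ : Matrix (Fin d × Fin d) (Fin d × Fin d) ℂ),
      ρ.PosSemidef ∧ f (osr ρ) < puriRank ρ := by
  obtain ⟨n, δ, hδ, hnot⟩ :=
    exists_slack_forall_not_psdFactorization ((Finset.range 4).sup f)
  refine ⟨n, slackState δ, PosSemidef.diagonal fun x => ?_, ?_⟩
  · exact Complex.zero_le_real.mpr (hδ x.1 x.2)
  obtain ⟨e, e', a, b, hab⟩ := Nat.sInf_mem
    (s := {r | ∃ (e f : ℕ) (a : Fin r → Matrix (Fin n) (Fin e) ℂ)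
      (b : Fin r → Matrix (Fin n) (Fin f) ℂ),
      slackState δ = (∑ i, a i ⊗ₖ b i) * (∑ i, a i ⊗ₖ b i)ᴴ}) (exists_purification_slackState hδ)
  obtain ⟨α, β, hfac⟩ := exists_psdFactorization_of_purification hab
  have hosr : f (osr (slackState δ)) ≤ (Finset.range 4).sup f :=
    Finset.le_sup (Finset.mem_range.mpr (Nat.lt_succ_iff.mpr (osr_slackState_le δ)))
  exact hosr.trans_lt (not_le.mp fun hle => hnot _ hle α β hfac)
end
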